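/- arXiv:0706.1765 — 2 statements merged into one kernel-verified Lean document; each statement's English description precedes it below -/
import Mathlib

section
/- Fix r ∈ ℕ and coprime a, b ∈ ℕ. Then Σ_{n ≤ x} τ_r(an) τ_r(bn)/n = C₂ f₂(a) f₂(b) ((log x)^{r²}/(r²)!) (1 + O(1/log x)) as x → ∞, where C₂ = Π_p (1 − 1/p)^{r²} Σ_{k≥0} τ_r(p^k)²/p^k. -/
open Filter Finset

/-- `τ_r(n)`, the `r`-th divisor function: the number of ordered `r`-tuples of positive
integers whose product is `n`; equivalently the coefficient of `n^{-s}` in `ζ(s)^r`. -/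
noncomputable def tauR (r n : ℕ) : ℕ := (ArithmeticFunction.zeta ^ r : ArithmeticFunction ℕ) n

/-- The multiplicative function `f₂` determined on prime powers by
`f₂(p^e) = (Σ_{j≥0} τ_r(p^{e+j}) τ_r(p^j)/p^j) / (Σ_{j≥0} τ_r(p^j)²/p^j)`. -/
noncomputable def fTwo (r n : ℕ) : ℝ :=
  ∏ p ∈ n.primeFactors,
    (∑' j : ℕ, ((tauR r (p ^ (n.factorization p + j)) : ℝ) * tauR r (p ^ j)) / p ^ j) /
      (∑' j : ℕ, ((tauR r (p ^ j) : ℝ)) ^ 2 / p ^ j)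

/-- `C₂ = Π_p (1 − 1/p)^{r²} Σ_{k≥0} τ_r(p^k)²/p^k`. -/
noncomputable def constC2 (r : ℕ) : ℝ :=
  ∏' p : Nat.Primes,
    ((1 - 1 / ((p : ℕ) : ℝ)) ^ (r ^ 2) *
      ∑' k : ℕ, ((tauR r ((p : ℕ) ^ k) : ℝ)) ^ 2 / (p : ℕ) ^ k)

/-- The arithmetic function `n ↦ f n / n`. -/
noncomputable def ArithmeticFunction.divId (f : ArithmeticFunction ℝ) : ArithmeticFunction ℝ :=
  ⟨fun n ↦ f n / n, by simp⟩

lemma ArithmeticFunction.divId_apply (f : ArithmeticFunction ℝ) (n : ℕ) :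
    f.divId n = f n / n := rfl

lemma ArithmeticFunction.divId_mul (f g : ArithmeticFunction ℝ) :
    (f * g).divId = f.divId * g.divId := by
  ext n
  simp only [divId_apply, mul_apply, Finset.sum_div]
  refine Finset.sum_congr rfl fun x hx ↦ ?_
  rw [← (Nat.mem_divisorsAntidiagonal.mp hx).1, Nat.cast_mul, div_mul_div_comm]

/-- The telescoping comparison of `∑ log (y / n) ^ k / n` with its integral. -/
lemma abs_sum_log_div_pow_div_sub_le (k : ℕ) {y : ℝ} (hy : 1 ≤ y) :
    |∑ n ∈ Ioc 0 ⌊y⌋₊, Real.log (y / n) ^ k / n - Real.log y ^ (k + 1) / (k + 1)|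
      ≤ Real.log y ^ k := by
  have hy0 : 0 < y := by linarith
  set L := Real.log y with hL
  have hL0 : 0 ≤ L := Real.log_nonneg hy
  set u : ℕ → ℝ := fun n ↦ max 0 (Real.log (y / n)) with hu
  have hu0 : ∀ n, 0 ≤ u n := fun n ↦ le_max_left _ _
  have hk : (0 : ℝ) < k + 1 := by positivity
  have hul : ∀ n : ℕ, 1 ≤ n → n ≤ ⌊y⌋₊ → u n = Real.log (y / n) := by
    intro n hn hny
    have : (n : ℝ) ≤ y := (Nat.le_floor_iff hy0.le).mp hny
    have hn' : (0 : ℝ) < n := by exact_mod_cast hn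
    exact max_eq_right (Real.log_nonneg (by rwa [le_div_iff₀ hn', one_mul]))
  have hu1 : u 1 = L := by
    rw [hul 1 le_rfl ((Nat.le_floor_iff hy0.le).mpr (by simpa using hy))]; simp [hL]
  have hlogdiff : ∀ n : ℕ, 1 ≤ n →
      Real.log (y / n) - Real.log (y / (n + 1 : ℕ)) = Real.log ((n + 1) / n) := by
    intro n hn
    have hn' : (0 : ℝ) < n := by exact_mod_cast hn
    rw [← Real.log_div (by positivity) (by positivity)]
    congr 1; push_cast; field_simp
  have hmono : ∀ n : ℕ, 1 ≤ n → u (n + 1) ≤ u n := by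
    intro n hn
    have hn' : (0 : ℝ) < n := by exact_mod_cast hn
    refine max_le_max le_rfl (Real.log_le_log (by positivity) ?_)
    gcongr; simp
  have hpow : ∀ {s t : ℝ}, 0 ≤ s → s ≤ t →
      (k + 1) * s ^ k * (t - s) ≤ t ^ (k + 1) - s ^ (k + 1) ∧
      t ^ (k + 1) - s ^ (k + 1) ≤ (k + 1) * t ^ k * (t - s) := by
    intro s t hs hst
    have ht : 0 ≤ t := hs.trans hst
    have hg := Commute.geom_sum₂_mul (Commute.all t s) (k + 1)
    rw [← hg]
    have hts : 0 ≤ t - s := by linarith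
    constructor
    · refine mul_le_mul_of_nonneg_right ?_ hts
      have : ∑ i ∈ range (k + 1), s ^ k ≤ ∑ i ∈ range (k + 1), t ^ i * s ^ (k + 1 - 1 - i) := by
        refine sum_le_sum fun i hi ↦ ?_
        have hik : i + (k - i) = k := by have := mem_range.mp hi; omega
        calc s ^ k = s ^ i * s ^ (k - i) := by rw [← pow_add, hik]
          _ ≤ _ := by simp only [Nat.add_sub_cancel]; gcongr
      simpa using this
    · refine mul_le_mul_of_nonneg_right ?_ hts
      have : ∑ i ∈ range (k + 1), t ^ i * s ^ (k + 1 - 1 - i) ≤ ∑ i ∈ range (k + 1), t ^ k := by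
        refine sum_le_sum fun i hi ↦ ?_
        have hik : i + (k - i) = k := by have := mem_range.mp hi; omega
        calc t ^ i * s ^ (k + 1 - 1 - i) ≤ t ^ i * t ^ (k - i) := by
              simp only [Nat.add_sub_cancel]; gcongr
          _ = t ^ k := by rw [← pow_add, hik]
      simpa using this
  have hlow : ∀ M : ℕ, (L ^ (k + 1) - u (M + 1) ^ (k + 1)) / (k + 1)
      ≤ ∑ n ∈ Ioc 0 M, u n ^ k / n := by
    intro M
    induction M with
    | zero => simp [hu1]
    | succ M ih =>
      rw [Finset.sum_Ioc_succ_top (Nat.zero_le M)]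
      have hM : (0 : ℝ) < (M + 1 : ℕ) := by positivity
      have h1 := (hpow (hu0 (M + 2)) (hmono (M + 1) (by omega))).2
      have h2 : u (M + 1) - u (M + 2) ≤ 1 / (M + 1 : ℕ) := by
        have h3 : Real.log (((M + 1 : ℕ) + 1) / (M + 1 : ℕ)) ≤ 1 / (M + 1 : ℕ) := by
          refine (Real.log_le_sub_one_of_pos (by positivity)).trans (le_of_eq ?_)
          field_simp; ring
        rw [← hlogdiff (M + 1) (by omega)] at h3
        have h4 : Real.log (y / (M + 2 : ℕ)) ≤ u (M + 2) := le_max_right _ _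
        have h5 : 0 ≤ u (M + 2) := hu0 _
        have : u (M + 1) ≤ u (M + 2) + 1 / (M + 1 : ℕ) := by
          refine max_le (by positivity) ?_
          have h6 : Real.log (y / (M + 1 + 1 : ℕ)) ≤ u (M + 2) := h4
          linarith
        linarith
      have h7 : (u (M + 1) ^ (k + 1) - u (M + 2) ^ (k + 1)) / (k + 1)
          ≤ u (M + 1) ^ k / (M + 1 : ℕ) := by
        rw [div_le_iff₀ hk]
        refine h1.trans ?_
        have : (k + 1) * u (M + 1) ^ k * (u (M + 1) - u (M + 2)) ≤
          (k + 1) * u (M + 1) ^ k * (1 / (M + 1 : ℕ)) := by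
          have := hu0 (M + 1)
          gcongr
        refine this.trans (le_of_eq ?_)
        ring
      have h8 : (L ^ (k + 1) - u (M + 2) ^ (k + 1)) / (k + 1) =
        (L ^ (k + 1) - u (M + 1) ^ (k + 1)) / (k + 1) +
        (u (M + 1) ^ (k + 1) - u (M + 2) ^ (k + 1)) / (k + 1) := by ring
      rw [show M + 1 + 1 = M + 2 from rfl, h8]
      linarith
  have hupp : ∀ M : ℕ, M + 1 ≤ ⌊y⌋₊ → ∑ n ∈ Ioc 0 (M + 1), u n ^ k / n
      ≤ L ^ k + (L ^ (k + 1) - u (M + 1) ^ (k + 1)) / (k + 1) := by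
    intro M
    induction M with
    | zero => intro _; simp [hu1]
    | succ M ih =>
      intro hM
      rw [Finset.sum_Ioc_succ_top (Nat.zero_le _)]
      have hM' : (0 : ℝ) < (M + 1 : ℕ) := by positivity
      have h1 := (hpow (hu0 (M + 2)) (hmono (M + 1) (by omega))).1
      have h2 : 1 / (M + 2 : ℕ) ≤ u (M + 1) - u (M + 2) := by
        rw [hul (M + 1) (by omega) (by omega), hul (M + 2) (by omega) hM,
          hlogdiff (M + 1) (by omega)]
        refine le_trans (le_of_eq ?_) (Real.one_sub_inv_le_log_of_pos (by positivity))
        push_cast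
        field_simp; ring
      have h7 : u (M + 2) ^ k / (M + 2 : ℕ) ≤
          (u (M + 1) ^ (k + 1) - u (M + 2) ^ (k + 1)) / (k + 1) := by
        rw [le_div_iff₀ hk]
        refine le_trans ?_ h1
        have : (k + 1) * u (M + 2) ^ k * (1 / (M + 2 : ℕ)) ≤
          (k + 1) * u (M + 2) ^ k * (u (M + 1) - u (M + 2)) := by
          have := hu0 (M + 2)
          gcongr
        refine le_trans (le_of_eq ?_) this
        ring
      have h8 : (L ^ (k + 1) - u (M + 2) ^ (k + 1)) / (k + 1) =
        (L ^ (k + 1) - u (M + 1) ^ (k + 1)) / (k + 1) +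
        (u (M + 1) ^ (k + 1) - u (M + 2) ^ (k + 1)) / (k + 1) := by ring
      rw [show M + 1 + 1 = M + 2 from rfl, h8]
      have := ih (by omega)
      linarith
  have hN : 1 ≤ ⌊y⌋₊ := (Nat.le_floor_iff hy0.le).mpr (by simpa using hy)
  have hsum : ∑ n ∈ Ioc 0 ⌊y⌋₊, Real.log (y / n) ^ k / n =
      ∑ n ∈ Ioc 0 ⌊y⌋₊, u n ^ k / n := by
    refine sum_congr rfl fun n hn ↦ ?_
    rw [mem_Ioc] at hn
    rw [hul n hn.1 hn.2]
  have hlast : u (⌊y⌋₊ + 1) = 0 := by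
    refine max_eq_left (Real.log_nonpos (by positivity) ?_)
    rw [div_le_one (by positivity)]
    push_cast
    exact (Nat.lt_floor_add_one y).le
  rw [hsum, abs_le]
  have e1 := hlow ⌊y⌋₊
  rw [hlast, zero_pow (by omega), sub_zero] at e1
  obtain ⟨M, hM⟩ := Nat.exists_eq_add_of_le' hN
  have e2 := hupp M hM.ge
  rw [← hM] at e2
  have e3 : (L ^ (k + 1) - u ⌊y⌋₊ ^ (k + 1)) / (k + 1) ≤ L ^ (k + 1) / (k + 1) := by
    gcongr
    have := pow_nonneg (hu0 ⌊y⌋₊) (k + 1)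
    linarith
  have e4 := pow_nonneg hL0 k
  constructor <;> linarith

lemma sum_Ioc_mul_div_eq (f g : ArithmeticFunction ℝ) (x : ℝ) :
    ∑ n ∈ Ioc 0 ⌊x⌋₊, (f * g) n / n =
      ∑ n ∈ Ioc 0 ⌊x⌋₊, f n / n * ∑ m ∈ Ioc 0 ⌊x / n⌋₊, g m / m := by
  have := ArithmeticFunction.sum_Ioc_mul_eq_sum_sum f.divId g.divId ⌊x⌋₊
  rw [← ArithmeticFunction.divId_mul] at this
  simpa only [ArithmeticFunction.divId_apply, Nat.floor_div_natCast] using this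

open ArithmeticFunction ArithmeticFunction.zeta in
/-- `∑_{n ≤ y} τ_k(n)/n = (log y)^k/k! + O((1 + log y)^{k-1})`, for `k = m + 1`. -/
lemma exists_abs_sum_zeta_pow_div_sub_le (m : ℕ) : ∃ C : ℝ, 0 ≤ C ∧ ∀ y : ℝ, 1 ≤ y →
    |∑ n ∈ Ioc 0 ⌊y⌋₊, ((ζ : ArithmeticFunction ℝ) ^ (m + 1)) n / n -
      Real.log y ^ (m + 1) / (m + 1).factorial| ≤ C * (1 + Real.log y) ^ m := by
  have hz : ∀ y : ℝ, ∀ n ∈ Ioc 0 ⌊y⌋₊, (ζ : ArithmeticFunction ℝ) n = 1 := by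
    intro y n hn
    have : n ≠ 0 := by have := (mem_Ioc.mp hn).1; omega
    simp [natCoe_apply, zeta_apply, this]
  induction m with
  | zero =>
    refine ⟨1, zero_le_one, fun y hy ↦ ?_⟩
    have := abs_sum_log_div_pow_div_sub_le 0 hy
    have h2 : ∑ n ∈ Ioc 0 ⌊y⌋₊, ((ζ : ArithmeticFunction ℝ) ^ (0 + 1)) n / n =
        ∑ n ∈ Ioc 0 ⌊y⌋₊, Real.log (y / n) ^ 0 / n := by
      refine sum_congr rfl fun n hn ↦ ?_
      rw [zero_add, pow_one, hz y n hn, pow_zero]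
    rw [h2]
    simpa using this
  | succ m ih =>
    obtain ⟨C, hC, h⟩ := ih
    refine ⟨C + 1, by positivity, fun y hy ↦ ?_⟩
    have hL : 0 ≤ Real.log y := Real.log_nonneg hy
    have hy0 : 0 < y := by linarith
    rw [pow_succ' (ζ : ArithmeticFunction ℝ), sum_Ioc_mul_div_eq]
    set T := ∑ n ∈ Ioc 0 ⌊y⌋₊, Real.log (y / n) ^ (m + 1) / n with hT
    have h1 := abs_sum_log_div_pow_div_sub_le (m + 1) hy
    have h0 := abs_sum_log_div_pow_div_sub_le 0 hy
    have h2 : |∑ n ∈ Ioc 0 ⌊y⌋₊, (ζ : ArithmeticFunction ℝ) n / n *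
        ∑ l ∈ Ioc 0 ⌊y / n⌋₊, ((ζ : ArithmeticFunction ℝ) ^ (m + 1)) l / l -
        T / (m + 1).factorial| ≤ C * (1 + Real.log y) ^ (m + 1) := by
      rw [hT, Finset.sum_div, ← sum_sub_distrib]
      refine (abs_sum_le_sum_abs _ _).trans ?_
      calc _ ≤ ∑ n ∈ Ioc 0 ⌊y⌋₊, C * (1 + Real.log y) ^ m * (1 / n) := by
            refine sum_le_sum fun n hn ↦ ?_
            rw [hz y n hn]
            have hn1 : (1 : ℝ) ≤ n := by exact_mod_cast (mem_Ioc.mp hn).1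
            have hny : (n : ℝ) ≤ y := (Nat.le_floor_iff hy0.le).mp (mem_Ioc.mp hn).2
            have hyn : 1 ≤ y / n := by rw [le_div_iff₀ (by linarith)]; linarith
            have hl0 : 0 ≤ Real.log (y / n) := Real.log_nonneg hyn
            have hl : Real.log (y / n) ≤ Real.log y :=
              Real.log_le_log (by positivity) (div_le_self hy0.le hn1)
            have := h (y / n) hyn
            have e : ∀ S : ℝ, 1 / (n : ℝ) * S -
                Real.log (y / n) ^ (m + 1) / n / (m + 1).factorial =
                (S - Real.log (y / n) ^ (m + 1) / (m + 1).factorial) * (1 / n) := by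
              intro S; field_simp
            rw [e, abs_mul, abs_of_nonneg (show (0 : ℝ) ≤ 1 / n by positivity)]
            have h9 : C * (1 + Real.log (y / n)) ^ m ≤ C * (1 + Real.log y) ^ m := by gcongr
            exact mul_le_mul_of_nonneg_right (this.trans h9) (by positivity)
        _ = C * (1 + Real.log y) ^ m * ∑ n ∈ Ioc 0 ⌊y⌋₊, (1 / n : ℝ) := by rw [mul_sum]
        _ ≤ C * (1 + Real.log y) ^ m * (1 + Real.log y) := by
            gcongr
            have := (abs_le.mp h0).2
            simp only [pow_zero, zero_add, pow_one, Nat.cast_zero, div_one] at this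
            linarith
        _ = _ := by ring
    have h3 : |T / (m + 1).factorial - Real.log y ^ (m + 1 + 1) / (m + 1 + 1).factorial| ≤
        (1 + Real.log y) ^ (m + 1) := by
      have e : T / (m + 1).factorial - Real.log y ^ (m + 1 + 1) / (m + 1 + 1).factorial =
          (T - Real.log y ^ (m + 1 + 1) / ((m + 1 : ℕ) + 1)) / (m + 1).factorial := by
        rw [Nat.factorial_succ (m + 1)]
        push_cast
        field_simp
      rw [e, abs_div, Nat.abs_cast]
      refine (div_le_self (abs_nonneg _) (by exact_mod_cast Nat.factorial_pos _)).trans ?_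
      refine h1.trans ?_
      gcongr
      linarith
    calc _ ≤ _ := abs_sub_le _ (T / (m + 1).factorial) _
      _ ≤ _ := add_le_add h2 h3
      _ = _ := by ring

open ArithmeticFunction ArithmeticFunction.zeta in
/-- If `∑ |h(d)| (1 + log d) / d` converges, then the convolution of `τ_k` with `h` has weighted
summatory function asymptotic to `(∑ h(d)/d) (log x)^k/k!`, where `k = m + 1`. -/
lemma isBigO_sum_zeta_pow_mul_div_sub (m : ℕ) (h : ArithmeticFunction ℝ)
    (hs : Summable fun d : ℕ ↦ |h d| / d * (1 + Real.log d)) :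
    (fun x : ℝ ↦ ∑ n ∈ Ioc 0 ⌊x⌋₊, ((ζ : ArithmeticFunction ℝ) ^ (m + 1) * h) n / n -
      (∑' d : ℕ, h d / d) * (Real.log x ^ (m + 1) / (m + 1).factorial)) =O[atTop]
      fun x ↦ Real.log x ^ m := by
  obtain ⟨C, hC, hS⟩ := exists_abs_sum_zeta_pow_div_sub_le m
  have hd1 : Summable fun d : ℕ ↦ h d / d := by
    refine Summable.of_norm_bounded hs fun d ↦ ?_
    rw [Real.norm_eq_abs, abs_div, Nat.abs_cast]
    exact le_mul_of_one_le_right (by positivity) (by linarith [Real.log_natCast_nonneg d])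
  set B := ∑' d : ℕ, |h d| / d * (1 + Real.log d) with hB
  refine Asymptotics.IsBigO.of_bound (B * (C + 1) * 2 ^ m) ?_
  filter_upwards [eventually_ge_atTop (Real.exp 1)] with x hx
  have hx0 : 0 < x := (Real.exp_pos 1).trans_le hx
  have hL1 : 1 ≤ Real.log x := by rwa [Real.le_log_iff_exp_le hx0]
  set L := Real.log x with hL
  have hx1 : 1 ≤ x := by
    by_contra hc
    have := Real.log_nonpos hx0.le (not_le.mp hc).le
    linarith
  set q : ℕ → ℝ := fun d ↦ if d ∈ Ioc 0 ⌊x⌋₊ then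
    ∑ l ∈ Ioc 0 ⌊x / d⌋₊, ((ζ : ArithmeticFunction ℝ) ^ (m + 1)) l / l else 0 with hq
  set A := L ^ (m + 1) / (m + 1).factorial with hA
  have hsum : HasSum (fun d : ℕ ↦ h d / d * q d)
      (∑ n ∈ Ioc 0 ⌊x⌋₊, ((ζ : ArithmeticFunction ℝ) ^ (m + 1) * h) n / n) := by
    rw [mul_comm, sum_Ioc_mul_div_eq]
    have : ∀ d ∉ Ioc 0 ⌊x⌋₊, h d / d * q d = 0 := by
      intro d hd; simp only [hq, if_neg hd, mul_zero]
    have h1 := hasSum_sum_of_ne_finset_zero (L := SummationFilter.unconditional ℕ) this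
    convert h1 using 1
    refine sum_congr rfl fun d hd ↦ ?_
    simp only [hq, if_pos hd]
  have hsub := hsum.sub (hd1.hasSum.mul_right A)
  rw [← hsub.tsum_eq]
  have hfac : (1 : ℝ) ≤ (m + 1).factorial := by exact_mod_cast Nat.factorial_pos _
  have hqA : ∀ d : ℕ, 1 ≤ d → |q d - A| ≤ (C + 1) * (2 * L) ^ m * (1 + Real.log d) := by
    intro d hd
    have hd' : (1 : ℝ) ≤ d := by exact_mod_cast hd
    have hld : 0 ≤ Real.log d := Real.log_nonneg hd'
    have hL2 : L ^ m ≤ (2 * L) ^ m := by gcongr; linarith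
    by_cases hdx : d ∈ Ioc 0 ⌊x⌋₊
    · have hdx' : (d : ℝ) ≤ x := (Nat.le_floor_iff hx0.le).mp (mem_Ioc.mp hdx).2
      have hxd : 1 ≤ x / d := by rw [le_div_iff₀ (by linarith)]; linarith
      have h1 := hS (x / d) hxd
      have hlog : Real.log (x / d) = L - Real.log d :=
        Real.log_div hx0.ne' (by linarith)
      have hl0 : 0 ≤ L - Real.log d := hlog ▸ Real.log_nonneg hxd
      rw [hlog] at h1
      have h2 : |(L - Real.log d) ^ (m + 1) / (m + 1).factorial - A| ≤ L ^ m * Real.log d := by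
        rw [hA, ← sub_div, abs_div, Nat.abs_cast, abs_sub_comm,
          abs_of_nonneg (sub_nonneg.mpr (by gcongr; linarith))]
        rw [div_le_iff₀ (by positivity)]
        have hg := Commute.geom_sum₂_mul (Commute.all L (L - Real.log d)) (m + 1)
        rw [← hg, sub_sub_cancel, mul_right_comm]
        refine mul_le_mul_of_nonneg_right ?_ hld
        calc ∑ i ∈ range (m + 1), L ^ i * (L - Real.log d) ^ (m + 1 - 1 - i)
            ≤ ∑ i ∈ range (m + 1), L ^ m := by
              refine sum_le_sum fun i hi ↦ ?_
              have hik : i + (m - i) = m := by have := mem_range.mp hi; omega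
              calc L ^ i * (L - Real.log d) ^ (m + 1 - 1 - i) ≤ L ^ i * L ^ (m - i) := by
                    simp only [Nat.add_sub_cancel]; gcongr; linarith
                _ = L ^ m := by rw [← pow_add, hik]
          _ = L ^ m * (m + 1 : ℕ) := by simp [mul_comm]
          _ ≤ L ^ m * (m + 1).factorial := by
              gcongr; exact Nat.self_le_factorial _
      have h3 : C * (1 + (L - Real.log d)) ^ m ≤ C * (2 * L) ^ m := by
        gcongr; linarith
      simp only [hq, if_pos hdx]
      calc _ ≤ _ := abs_sub_le _ ((L - Real.log d) ^ (m + 1) / (m + 1).factorial) _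
        _ ≤ C * (2 * L) ^ m + L ^ m * Real.log d := add_le_add (h1.trans h3) h2
        _ ≤ C * (2 * L) ^ m + (2 * L) ^ m * Real.log d := by gcongr
        _ ≤ _ := by
            have : 0 ≤ (2 * L) ^ m := by positivity
            nlinarith [mul_nonneg hC (mul_nonneg this hld)]
    · have hdx' : x ≤ d := by
        have : ⌊x⌋₊ < d := by
          by_contra hc
          exact hdx (mem_Ioc.mpr ⟨hd, not_lt.mp hc⟩)
        exact (Nat.lt_of_floor_lt this).le
      have hLd : L ≤ Real.log d := Real.log_le_log hx0 hdx'
      simp only [hq, if_neg hdx, zero_sub, abs_neg]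
      rw [abs_of_nonneg (by positivity)]
      calc A ≤ L ^ (m + 1) := div_le_self (by positivity) hfac
        _ = 1 * L ^ m * L := by ring
        _ ≤ (C + 1) * (2 * L) ^ m * (1 + Real.log d) := by gcongr <;> linarith
  have hbound : ∀ d : ℕ, ‖h d / d * q d - h d / d * A‖ ≤
      |h d| / d * (1 + Real.log d) * ((C + 1) * (2 * L) ^ m) := by
    intro d
    rcases Nat.eq_zero_or_pos d with rfl | hd
    · simp
    rw [← mul_sub, norm_mul, Real.norm_eq_abs, Real.norm_eq_abs, abs_div, Nat.abs_cast]
    calc _ ≤ |h d| / d * ((C + 1) * (2 * L) ^ m * (1 + Real.log d)) := by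
          gcongr; exact hqA d hd
      _ = _ := by ring
  refine (tsum_of_norm_bounded (hs.hasSum.mul_right _) hbound).trans (le_of_eq ?_)
  rw [Real.norm_of_nonneg (by positivity), ← hB]
  ring

/-- A nonnegative multiplicative function is summable if the prime-power tails are. -/
lemma summable_of_multiplicative_of_summable_primes {f : ℕ → ℝ} (hf0 : f 0 = 0)
    (hf1 : f 1 = 1) (hmul : ∀ {m n : ℕ}, m.Coprime n → f (m * n) = f m * f n)
    (hnn : ∀ n, 0 ≤ f n) (hp : ∀ p : ℕ, p.Prime → Summable fun e : ℕ ↦ f (p ^ e))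
    (hs : Summable fun p : Nat.Primes ↦ ∑' e : ℕ, f ((p : ℕ) ^ (e + 1))) :
    Summable f := by
  set t : ℕ → ℝ := fun p ↦ ∑' e : ℕ, f (p ^ (e + 1)) with ht
  have ht0 : ∀ p, 0 ≤ t p := fun p ↦ tsum_nonneg fun _ ↦ hnn _
  refine summable_of_sum_range_le (c := Real.exp (∑' p : Nat.Primes, t p)) hnn fun N ↦ ?_
  obtain ⟨h1, h2⟩ := EulerProduct.summable_and_hasSum_factoredNumbers_prod_filter_prime_tsum
    hf1 hmul (fun {p} hpp ↦ by simpa [abs_of_nonneg, hnn] using hp p hpp) (range N)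
  have hle : ∑ n ∈ range N, f n ≤ ∏ p ∈ range N with p.Prime, ∑' n : ℕ, f (p ^ n) := by
    rw [← h2.tsum_eq]
    have h3 : ∑ n ∈ range N, f n = ∑ n ∈ (range N).erase 0, f n := by
      by_cases h0 : 0 ∈ range N
      · rw [← Finset.add_sum_erase _ _ h0, hf0, zero_add]
      · rw [Finset.erase_eq_of_notMem h0]
    have h4 : ∀ n ∈ (range N).erase 0, n ∈ Nat.factoredNumbers (range N) := by
      intro n hn
      rw [mem_erase, mem_range] at hn
      exact ⟨hn.1, fun p hp ↦ mem_range.mpr ((Nat.le_of_mem_primeFactorsList hp).trans_lt hn.2)⟩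
    rw [h3, ← Finset.sum_subtype_of_mem f h4]
    exact h2.summable.sum_le_tsum _ fun i _ ↦ hnn i
  refine hle.trans ?_
  calc ∏ p ∈ range N with p.Prime, ∑' n : ℕ, f (p ^ n)
      ≤ ∏ p ∈ range N with p.Prime, Real.exp (t p) := by
        refine prod_le_prod (fun p _ ↦ tsum_nonneg fun _ ↦ hnn _) fun p hpm ↦ ?_
        rw [(hp p (mem_filter.mp hpm).2).tsum_eq_zero_add, pow_zero, hf1, add_comm]
        exact Real.add_one_le_exp _
    _ = Real.exp (∑ p ∈ range N with p.Prime, t p) := (Real.exp_sum _ _).symm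
    _ ≤ _ := by
        refine Real.exp_le_exp.mpr ?_
        rw [← Finset.sum_subtype_of_mem t (p := Nat.Prime) fun p hpm ↦ (mem_filter.mp hpm).2]
        exact hs.sum_le_tsum (_ : Finset Nat.Primes) fun p _ ↦ ht0 p

section PrimePowers

open ArithmeticFunction ArithmeticFunction.zeta ArithmeticFunction.Moebius

lemma ArithmeticFunction.IsMultiplicative.pow' {R : Type*} [CommSemiring R]
    {f : ArithmeticFunction R} (hf : f.IsMultiplicative) (k : ℕ) : (f ^ k).IsMultiplicative := by
  induction k with
  | zero => rw [pow_zero]; exact isMultiplicative_one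
  | succ k ih => rw [pow_succ]; exact ih.mul hf

lemma ArithmeticFunction.mul_apply_prime_pow {R : Type*} [Semiring R] (f g : ArithmeticFunction R)
    {p : ℕ} (hp : p.Prime) (e : ℕ) :
    (f * g) (p ^ e) = ∑ x ∈ antidiagonal e, f (p ^ x.1) * g (p ^ x.2) := by
  rw [mul_apply, Nat.sum_divisorsAntidiagonal (f := fun i j ↦ f i * g j),
    Nat.sum_divisors_prime_pow hp,
    Finset.Nat.sum_antidiagonal_eq_sum_range_succ (fun i j ↦ f (p ^ i) * g (p ^ j))]
  refine sum_congr rfl fun i hi ↦ ?_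
  rw [Nat.pow_div (Nat.lt_succ_iff.mp (mem_range.mp hi)) hp.pos]

lemma ArithmeticFunction.abs_pow_apply_prime_pow_le {f : ArithmeticFunction ℝ} {p : ℕ}
    (hp : p.Prime) (hf : ∀ i : ℕ, |f (p ^ i)| ≤ 1) (k e : ℕ) :
    |(f ^ k) (p ^ e)| ≤ ((e : ℝ) + 1) ^ k := by
  induction k generalizing e with
  | zero =>
    rw [pow_zero, pow_zero, one_apply]
    split_ifs <;> simp
  | succ k ih =>
    rw [pow_succ, mul_apply_prime_pow _ _ hp]
    calc _ ≤ ∑ x ∈ antidiagonal e, |(f ^ k) (p ^ x.1) * f (p ^ x.2)| := abs_sum_le_sum_abs _ _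
      _ ≤ ∑ x ∈ antidiagonal e, ((e : ℝ) + 1) ^ k := by
          refine sum_le_sum fun x hx ↦ ?_
          have hxe : (x.1 : ℝ) ≤ e := by
            exact_mod_cast (by have := mem_antidiagonal.mp hx; omega : x.1 ≤ e)
          rw [abs_mul]
          calc _ ≤ ((x.1 : ℝ) + 1) ^ k * 1 :=
                mul_le_mul (ih x.1) (hf x.2) (abs_nonneg _) (by positivity)
            _ ≤ _ := by rw [mul_one]; gcongr
      _ = ((e : ℝ) + 1) ^ (k + 1) := by
          rw [sum_const, Finset.Nat.card_antidiagonal, nsmul_eq_mul, pow_succ]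
          push_cast; ring

lemma ArithmeticFunction.mul_apply_prime {R : Type*} [Semiring R] (f g : ArithmeticFunction R)
    {p : ℕ} (hp : p.Prime) : (f * g) p = f 1 * g p + f p * g 1 := by
  have h := mul_apply_prime_pow f g hp 1
  rw [Finset.Nat.sum_antidiagonal_eq_sum_range_succ (fun i j ↦ f (p ^ i) * g (p ^ j))] at h
  simpa [sum_range_succ] using h

lemma ArithmeticFunction.pow_apply_prime {R : Type*} [CommSemiring R] {f : ArithmeticFunction R}
    (hf : f.IsMultiplicative) {p : ℕ} (hp : p.Prime) (k : ℕ) : (f ^ k) p = k * f p := by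
  induction k with
  | zero => simp [hp.ne_one]
  | succ k ih =>
    rw [pow_succ, mul_apply_prime _ _ hp, hf.map_one, (hf.pow' k).map_one, ih]
    push_cast
    ring

lemma tauR_cast (r n : ℕ) : (tauR r n : ℝ) = ((ζ : ArithmeticFunction ℝ) ^ r) n := by
  have h : ((ArithmeticFunction.zeta ^ r : ArithmeticFunction ℕ) : ArithmeticFunction ℝ) =
      (ζ : ArithmeticFunction ℝ) ^ r := by
    induction r with
    | zero => simp
    | succ r ih => rw [pow_succ, natCoe_mul, ih, pow_succ]
  rw [← h, natCoe_apply, tauR]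

lemma tauR_pos {r n : ℕ} (hr : 1 ≤ r) (hn : n ≠ 0) : 0 < tauR r n := by
  obtain ⟨m, rfl⟩ := Nat.exists_eq_add_of_le' hr
  clear hr
  unfold tauR
  rw [pow_succ, mul_zeta_apply]
  have h1 : (ArithmeticFunction.zeta ^ m : ArithmeticFunction ℕ) 1 = 1 :=
    (isMultiplicative_zeta.pow' m).map_one
  calc 0 < (ArithmeticFunction.zeta ^ m : ArithmeticFunction ℕ) 1 := by rw [h1]; exact one_pos
    _ ≤ _ := single_le_sum (f := fun i ↦ (ArithmeticFunction.zeta ^ m : ArithmeticFunction ℕ) i)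
      (fun _ _ ↦ Nat.zero_le _) (Nat.one_mem_divisors.mpr hn)

lemma tauR_zero (r : ℕ) : tauR r 0 = 0 := ArithmeticFunction.map_zero

lemma tauR_mul_of_coprime (r : ℕ) {m n : ℕ} (h : m.Coprime n) :
    tauR r (m * n) = tauR r m * tauR r n :=
  (isMultiplicative_zeta.pow' r).map_mul_of_coprime h

lemma tauR_one (r : ℕ) : tauR r 1 = 1 := (isMultiplicative_zeta.pow' r).map_one

lemma tauR_prime_pow_le (r : ℕ) {p : ℕ} (hp : p.Prime) (e : ℕ) :
    (tauR r (p ^ e) : ℝ) ≤ ((e : ℝ) + 1) ^ r := by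
  rw [tauR_cast]
  refine (le_abs_self _).trans (abs_pow_apply_prime_pow_le hp (fun i ↦ ?_) r e)
  rw [natCoe_apply, zeta_apply]
  split_ifs <;> simp

lemma tauR_prime (r : ℕ) {p : ℕ} (hp : p.Prime) : tauR r p = r := by
  rw [tauR, pow_apply_prime isMultiplicative_zeta hp, zeta_apply, if_neg hp.ne_zero]
  simp

lemma tauR_mul_prime_pow (r : ℕ) {a p : ℕ} (ha : a ≠ 0) (hp : p.Prime) (e : ℕ) :
    tauR r (a * p ^ e) = tauR r (ordCompl[p] a) * tauR r (p ^ (a.factorization p + e)) := by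
  rw [← tauR_mul_of_coprime]
  · congr 1
    rw [pow_add, ← mul_assoc, mul_comm (ordCompl[p] a), Nat.ordProj_mul_ordCompl_eq_self]
  · exact (Nat.Coprime.pow_left _ (Nat.coprime_ordCompl hp ha)).symm

lemma tauR_eq_prod (r : ℕ) {a : ℕ} (ha : a ≠ 0) :
    tauR r a = ∏ p ∈ a.primeFactors, tauR r (p ^ a.factorization p) := by
  have := (isMultiplicative_zeta.pow' r).multiplicative_factorization
    (ArithmeticFunction.zeta ^ r : ArithmeticFunction ℕ) ha
  rwa [Nat.prod_factorization_eq_prod_primeFactors] at this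

/-- The normalised function `n ↦ τ_r(an) τ_r(bn) / (τ_r(a) τ_r(b))`. -/
noncomputable def tauShift (r a b : ℕ) : ArithmeticFunction ℝ :=
  ⟨fun n ↦ (tauR r (a * n) : ℝ) * tauR r (b * n) / (tauR r a * tauR r b), by simp [tauR_zero]⟩

lemma tauShift_apply (r a b n : ℕ) :
    tauShift r a b n = (tauR r (a * n) : ℝ) * tauR r (b * n) / (tauR r a * tauR r b) := rfl

lemma tauR_mul_mul_of_coprime (r a : ℕ) {m n : ℕ} (h : m.Coprime n) :
    tauR r (a * (m * n)) * tauR r a = tauR r (a * m) * tauR r (a * n) := by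
  have := (isMultiplicative_zeta.pow' r).lcm_apply_mul_gcd_apply (x := a * m) (y := a * n)
  rwa [Nat.lcm_mul_left, Nat.gcd_mul_left, h.lcm_eq_mul, h.gcd_eq_one, mul_one] at this

lemma isMultiplicative_tauShift {r a b : ℕ} (hr : 1 ≤ r) (ha : a ≠ 0) (hb : b ≠ 0) :
    (tauShift r a b).IsMultiplicative := by
  have h1 : (tauR r a : ℝ) ≠ 0 := by exact_mod_cast (tauR_pos hr ha).ne'
  have h2 : (tauR r b : ℝ) ≠ 0 := by exact_mod_cast (tauR_pos hr hb).ne'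
  refine ⟨by simp [tauShift_apply, h1, h2], fun {m n} h ↦ ?_⟩
  have h3 : (tauR r (a * (m * n)) : ℝ) * tauR r a = tauR r (a * m) * tauR r (a * n) := by
    exact_mod_cast tauR_mul_mul_of_coprime r a h
  have h4 : (tauR r (b * (m * n)) : ℝ) * tauR r b = tauR r (b * m) * tauR r (b * n) := by
    exact_mod_cast tauR_mul_mul_of_coprime r b h
  simp only [tauShift_apply]
  field_simp
  linear_combination (tauR r (b * (m * n)) : ℝ) * tauR r b * h3 +
    (tauR r (a * m) : ℝ) * tauR r (a * n) * h4

lemma tauShift_prime_pow {r a b p : ℕ} (hr : 1 ≤ r) (ha : a ≠ 0) (hb : b ≠ 0) (hp : p.Prime)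
    (e : ℕ) : tauShift r a b (p ^ e) =
      (tauR r (p ^ (a.factorization p + e)) : ℝ) * tauR r (p ^ (b.factorization p + e)) /
        (tauR r (p ^ a.factorization p) * tauR r (p ^ b.factorization p)) := by
  have h (c : ℕ) (hc : c ≠ 0) : (0 : ℝ) < tauR r c := by exact_mod_cast tauR_pos hr hc
  have ha0 := tauR_mul_prime_pow r ha hp 0
  have hb0 := tauR_mul_prime_pow r hb hp 0
  rw [pow_zero, mul_one, add_zero] at ha0 hb0
  have h1 := h _ (Nat.ordCompl_pos p ha).ne'
  have h2 := h _ (Nat.ordCompl_pos p hb).ne'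
  have h3 := h (p ^ a.factorization p) (pow_ne_zero _ hp.ne_zero)
  have h4 := h (p ^ b.factorization p) (pow_ne_zero _ hp.ne_zero)
  rw [tauShift_apply, tauR_mul_prime_pow r ha hp, tauR_mul_prime_pow r hb hp, ha0, hb0]
  push_cast
  field_simp

lemma abs_tauShift_prime_pow_le {r a b p : ℕ} (hr : 1 ≤ r) (ha : a ≠ 0) (hb : b ≠ 0)
    (hp : p.Prime) (e : ℕ) :
    |tauShift r a b (p ^ e)| ≤ ((a + b + e : ℕ) + 1 : ℝ) ^ (2 * r) := by
  have h (c : ℕ) : (1 : ℝ) ≤ tauR r (p ^ c) := by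
    exact_mod_cast tauR_pos hr (pow_ne_zero c hp.ne_zero)
  rw [tauShift_prime_pow hr ha hb hp, abs_of_nonneg (by positivity)]
  refine (div_le_self (by positivity) (one_le_mul_of_one_le_of_one_le (h _) (h _))).trans ?_
  have key (c : ℕ) (hc : c ≤ a + b) :
      (tauR r (p ^ (c + e)) : ℝ) ≤ ((a + b + e : ℕ) + 1 : ℝ) ^ r := by
    refine (tauR_prime_pow_le r hp _).trans ?_
    gcongr
  rw [two_mul, pow_add (_ + _ : ℝ)]
  exact mul_le_mul (key _ ((Nat.factorization_lt p ha).le.trans (Nat.le_add_right _ _)))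
    (key _ ((Nat.factorization_lt p hb).le.trans (Nat.le_add_left _ _))) (by positivity)
    (by positivity)

/-- The function `h` with `tauShift = τ_{r²} * h`. -/
noncomputable def tauRem (r a b : ℕ) : ArithmeticFunction ℝ :=
  (μ : ArithmeticFunction ℝ) ^ (r ^ 2) * tauShift r a b

lemma zeta_pow_mul_tauRem (r a b : ℕ) :
    (ζ : ArithmeticFunction ℝ) ^ (r ^ 2) * tauRem r a b = tauShift r a b := by
  rw [tauRem, ← mul_assoc, ← mul_pow, coe_zeta_mul_coe_moebius, one_pow, one_mul]

lemma isMultiplicative_moebius_real : (μ : ArithmeticFunction ℝ).IsMultiplicative :=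
  isMultiplicative_moebius.intCast

lemma isMultiplicative_tauRem {r a b : ℕ} (hr : 1 ≤ r) (ha : a ≠ 0) (hb : b ≠ 0) :
    (tauRem r a b).IsMultiplicative :=
  (isMultiplicative_moebius_real.pow' _).mul (isMultiplicative_tauShift hr ha hb)

lemma abs_tauRem_prime_pow_le {r a b p : ℕ} (hr : 1 ≤ r) (ha : a ≠ 0) (hb : b ≠ 0)
    (hp : p.Prime) (e : ℕ) :
    |tauRem r a b (p ^ e)| ≤ ((a + b + e : ℕ) + 1 : ℝ) ^ (1 + r ^ 2 + 2 * r) := by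
  rw [tauRem, mul_apply_prime_pow _ _ hp]
  have hmu (i : ℕ) : |(μ : ArithmeticFunction ℝ) (p ^ i)| ≤ 1 := by
    rw [intCoe_apply]
    exact_mod_cast abs_moebius_le_one
  calc _ ≤ ∑ x ∈ antidiagonal e,
          |((μ : ArithmeticFunction ℝ) ^ (r ^ 2)) (p ^ x.1) * tauShift r a b (p ^ x.2)| :=
        abs_sum_le_sum_abs _ _
    _ ≤ ∑ x ∈ antidiagonal e, ((a + b + e : ℕ) + 1 : ℝ) ^ (r ^ 2 + 2 * r) := by
        refine sum_le_sum fun x hx ↦ ?_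
        have hxe := mem_antidiagonal.mp hx
        rw [abs_mul, pow_add]
        refine mul_le_mul ((abs_pow_apply_prime_pow_le hp hmu _ _).trans ?_)
          ((abs_tauShift_prime_pow_le hr ha hb hp _).trans ?_) (abs_nonneg _) (by positivity)
        · gcongr; omega
        · gcongr; omega
    _ = ((e + 1 : ℕ) : ℝ) * ((a + b + e : ℕ) + 1 : ℝ) ^ (r ^ 2 + 2 * r) := by
        rw [sum_const, Finset.Nat.card_antidiagonal, nsmul_eq_mul]
    _ ≤ ((a + b + e : ℕ) + 1 : ℝ) * ((a + b + e : ℕ) + 1 : ℝ) ^ (r ^ 2 + 2 * r) := by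
        gcongr
        exact_mod_cast (by omega : e + 1 ≤ a + b + e + 1)
    _ = _ := by ring

lemma tauRem_prime {r a b p : ℕ} (hr : 1 ≤ r) (ha : a ≠ 0) (hb : b ≠ 0)
    (hp : p.Prime) (hab : ¬ p ∣ a * b) : tauRem r a b p = 0 := by
  have hpa : a.factorization p = 0 :=
    Nat.factorization_eq_zero_of_not_dvd fun h ↦ hab (h.mul_right b)
  have hpb : b.factorization p = 0 :=
    Nat.factorization_eq_zero_of_not_dvd fun h ↦ hab (h.mul_left a)
  have hG := tauShift_prime_pow hr ha hb hp 1
  rw [hpa, hpb, pow_zero, tauR_one, zero_add, pow_one, tauR_prime r hp] at hG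
  rw [tauRem, mul_apply_prime _ _ hp, hG, (isMultiplicative_tauShift hr ha hb).map_one,
    (isMultiplicative_moebius_real.pow' _).map_one,
    pow_apply_prime isMultiplicative_moebius_real hp, intCoe_apply, moebius_apply_prime hp]
  push_cast
  ring

end PrimePowers

lemma summable_add_pow_mul_geometric (A M : ℕ) {ρ : ℝ} (h0 : 0 < ρ) (h1 : ρ < 1) :
    Summable fun e : ℕ ↦ ((A + e : ℕ) + 1 : ℝ) ^ M * ρ ^ e := by
  have h := summable_pow_mul_geometric_of_norm_lt_one (R := ℝ) M
    (r := ρ) (by rwa [Real.norm_of_nonneg h0.le])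
  have h2 := ((summable_nat_add_iff (A + 1)).mpr h).mul_right (ρ ^ (A + 1))⁻¹
  refine h2.congr fun e ↦ ?_
  rw [pow_add ρ e (A + 1), ← mul_assoc, mul_assoc _ (ρ ^ (A + 1)), mul_inv_cancel₀ (by positivity),
    mul_one]
  push_cast
  ring

/-- Summability of the prime-power tails of `tauRem` with weight `n ^ (-3/4)`. -/
lemma summable_tauRem_primes {r a b : ℕ} (hr : 1 ≤ r) (ha : a ≠ 0) (hb : b ≠ 0) :
    (∀ p : ℕ, p.Prime → Summable fun e : ℕ ↦
      |tauRem r a b (p ^ e)| * ((p ^ e : ℕ) : ℝ) ^ (-(3 / 4) : ℝ)) ∧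
    Summable fun p : Nat.Primes ↦ ∑' e : ℕ,
      |tauRem r a b ((p : ℕ) ^ (e + 1))| * (((p : ℕ) ^ (e + 1) : ℕ) : ℝ) ^ (-(3 / 4) : ℝ) := by
  set M := 1 + r ^ 2 + 2 * r
  set ρ : ℝ := (2 : ℝ) ^ (-(3 / 4) : ℝ) with hρ
  have hρ0 : 0 < ρ := by positivity
  have hρ1 : ρ < 1 := Real.rpow_lt_one_of_one_lt_of_neg (by norm_num) (by norm_num)
  have hq (p : ℕ) (e : ℕ) : ((p ^ e : ℕ) : ℝ) ^ (-(3 / 4) : ℝ) =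
      ((p : ℝ) ^ (-(3 / 4) : ℝ)) ^ e := by
    rw [Nat.cast_pow, ← Real.rpow_natCast, ← Real.rpow_natCast, ← Real.rpow_mul (by positivity),
      ← Real.rpow_mul (by positivity), mul_comm]
  have hqρ (p : ℕ) (hp : p.Prime) : (p : ℝ) ^ (-(3 / 4) : ℝ) ≤ ρ :=
    Real.rpow_le_rpow_of_nonpos (by norm_num) (by exact_mod_cast hp.two_le) (by norm_num)
  have hsum (p : ℕ) (hp : p.Prime) : Summable fun e : ℕ ↦
      |tauRem r a b (p ^ e)| * ((p ^ e : ℕ) : ℝ) ^ (-(3 / 4) : ℝ) := by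
    refine Summable.of_nonneg_of_le (fun e ↦ by positivity) (fun e ↦ ?_)
      (summable_add_pow_mul_geometric (a + b) M hρ0 hρ1)
    rw [hq]
    exact mul_le_mul (abs_tauRem_prime_pow_le hr ha hb hp e)
      (pow_le_pow_left₀ (by positivity) (hqρ p hp) e) (by positivity) (by positivity)
  refine ⟨hsum, ?_⟩
  have hKs := summable_add_pow_mul_geometric (a + b + 2) M hρ0 hρ1
  set K := ∑' e : ℕ, ((a + b + 2 + e : ℕ) + 1 : ℝ) ^ M * ρ ^ e
  have hfin : Summable fun p : Nat.Primes ↦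
      |tauRem r a b p| * ((p : ℕ) : ℝ) ^ (-(3 / 4) : ℝ) := by
    have hf : (Set.Finite {p : Nat.Primes | (p : ℕ) ∣ a * b}) := by
      refine Set.Finite.of_finite_image (f := fun p : Nat.Primes ↦ (p : ℕ)) ?_
        (Subtype.val_injective.injOn)
      refine (Nat.divisors (a * b)).finite_toSet.subset ?_
      rintro _ ⟨p, hp, rfl⟩
      exact Nat.mem_divisors.mpr ⟨hp, mul_ne_zero ha hb⟩
    refine summable_of_hasFiniteSupport (hf.subset fun p hp ↦ ?_)
    by_contra hc
    exact hp (by simp [tauRem_prime hr ha hb p.2 hc])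
  have hprimes : Summable fun p : Nat.Primes ↦ (((p : ℕ) : ℝ) ^ (-(3 / 2) : ℝ)) * K :=
    (Nat.Primes.summable_rpow.mpr (by norm_num)).mul_right K
  refine Summable.of_nonneg_of_le (fun p ↦ tsum_nonneg fun e ↦ by positivity) (fun p ↦ ?_)
    (hfin.add hprimes)
  have hs1 := (summable_nat_add_iff 1).mpr (hsum p p.2)
  have hs2 := (summable_nat_add_iff 2).mpr (hsum p p.2)
  rw [hs1.tsum_eq_zero_add, zero_add, pow_one, ← tsum_mul_left]
  refine add_le_add le_rfl (Summable.tsum_le_tsum (fun e ↦ ?_) hs2 (hKs.mul_left _))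
  rw [hq, add_assoc, one_add_one_eq_two, pow_add (_ ^ _ : ℝ) e 2]
  have h1 := abs_tauRem_prime_pow_le hr ha hb p.2 (e + 2)
  have h2 : (((p : ℕ) : ℝ) ^ (-(3 / 4) : ℝ)) ^ 2 = ((p : ℕ) : ℝ) ^ (-(3 / 2) : ℝ) := by
    rw [← Real.rpow_natCast, ← Real.rpow_mul (by positivity)]; norm_num
  have h3 := pow_le_pow_left₀ (by positivity) (hqρ p p.2) e
  rw [h2]
  calc _ ≤ ((a + b + (e + 2) : ℕ) + 1 : ℝ) ^ M *
        (ρ ^ e * ((p : ℕ) : ℝ) ^ (-(3 / 2) : ℝ)) := by gcongr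
    _ = _ := by
      rw [show a + b + (e + 2) = a + b + 2 + e by ring]; ring

lemma summable_tauRem {r a b : ℕ} (hr : 1 ≤ r) (ha : a ≠ 0) (hb : b ≠ 0) :
    Summable fun n : ℕ ↦ |tauRem r a b n| * (n : ℝ) ^ (-(3 / 4) : ℝ) := by
  have hm := isMultiplicative_tauRem hr ha hb
  obtain ⟨h1, h2⟩ := summable_tauRem_primes hr ha hb
  refine summable_of_multiplicative_of_summable_primes (by simp) (by simp [hm.map_one])
    (fun {m n} h ↦ ?_) (fun n ↦ by positivity) h1 h2
  rw [hm.map_mul_of_coprime h, abs_mul, Nat.cast_mul,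
    Real.mul_rpow (by positivity) (by positivity)]
  ring

lemma summable_abs_tauRem_div_mul_log {r a b : ℕ} (hr : 1 ≤ r) (ha : a ≠ 0) (hb : b ≠ 0) :
    Summable fun d : ℕ ↦ |tauRem r a b d| / d * (1 + Real.log d) := by
  refine Summable.of_nonneg_of_le (fun d ↦ ?_) (fun d ↦ ?_)
    ((summable_tauRem hr ha hb).mul_right 5)
  · have := Real.log_natCast_nonneg d
    positivity
  rcases Nat.eq_zero_or_pos d with rfl | hd
  · simp
  have hd1 : (1 : ℝ) ≤ d := by exact_mod_cast hd
  have h1 : Real.log d ≤ (d : ℝ) ^ (1 / 4 : ℝ) / (1 / 4) :=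
    Real.log_le_rpow_div (by positivity) (by norm_num)
  have h2 : (1 : ℝ) ≤ (d : ℝ) ^ (1 / 4 : ℝ) := Real.one_le_rpow hd1 (by norm_num)
  have h3 : (d : ℝ) ^ (-(3 / 4) : ℝ) = (d : ℝ) ^ (1 / 4 : ℝ) / d := by
    rw [show (-(3 / 4) : ℝ) = 1 / 4 - 1 by norm_num, Real.rpow_sub_one (by positivity)]
  rw [h3]
  calc |tauRem r a b d| / d * (1 + Real.log d)
      ≤ |tauRem r a b d| / d * (5 * (d : ℝ) ^ (1 / 4 : ℝ)) := by gcongr; linarith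
    _ = _ := by ring

section EulerFactors

open ArithmeticFunction ArithmeticFunction.zeta

lemma ArithmeticFunction.tsum_mul_prime_pow {f g : ArithmeticFunction ℝ} {p : ℕ} (hp : p.Prime)
    (hf : Summable fun e : ℕ ↦ ‖f (p ^ e) / (p : ℝ) ^ e‖)
    (hg : Summable fun e : ℕ ↦ ‖g (p ^ e) / (p : ℝ) ^ e‖) :
    (Summable fun e : ℕ ↦ ‖(f * g) (p ^ e) / (p : ℝ) ^ e‖) ∧
    ∑' e : ℕ, (f * g) (p ^ e) / (p : ℝ) ^ e =
      (∑' e : ℕ, f (p ^ e) / (p : ℝ) ^ e) * ∑' e : ℕ, g (p ^ e) / (p : ℝ) ^ e := by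
  have key (e : ℕ) : (f * g) (p ^ e) / (p : ℝ) ^ e =
      ∑ x ∈ antidiagonal e, f (p ^ x.1) / (p : ℝ) ^ x.1 * (g (p ^ x.2) / (p : ℝ) ^ x.2) := by
    rw [mul_apply_prime_pow f g hp, Finset.sum_div]
    refine sum_congr rfl fun x hx ↦ ?_
    rw [← mem_antidiagonal.mp hx, pow_add, div_mul_div_comm]
  have h1 := summable_norm_sum_mul_antidiagonal_of_summable_norm hf hg
  have h2 := tsum_mul_tsum_eq_tsum_sum_antidiagonal_of_summable_norm hf hg
  simp only [← key] at h1 h2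
  exact ⟨h1, h2.symm⟩

lemma tsum_zeta_pow_prime_pow {p : ℕ} (hp : p.Prime) (k : ℕ) :
    (Summable fun e : ℕ ↦ ‖((ζ : ArithmeticFunction ℝ) ^ k) (p ^ e) / (p : ℝ) ^ e‖) ∧
    ∑' e : ℕ, ((ζ : ArithmeticFunction ℝ) ^ k) (p ^ e) / (p : ℝ) ^ e =
      ((1 - 1 / (p : ℝ)) ^ k)⁻¹ := by
  have hp1 : (1 : ℝ) < p := by exact_mod_cast hp.one_lt
  have hlt : 1 / (p : ℝ) < 1 := by rw [div_lt_one (by linarith)]; exact hp1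
  induction k with
  | zero =>
    have h (e : ℕ) (he : e ≠ 0) :
        ((ζ : ArithmeticFunction ℝ) ^ 0) (p ^ e) / (p : ℝ) ^ e = 0 := by
      rw [pow_zero, one_apply, if_neg, zero_div]
      simpa [he] using hp.ne_one
    constructor
    · refine summable_of_ne_finset_zero (s := {0}) fun e he ↦ ?_
      rw [h e (by simpa using he), norm_zero]
    · rw [tsum_eq_single 0 h]; simp
  | succ k ih =>
    have h (e : ℕ) : (ζ : ArithmeticFunction ℝ) (p ^ e) / (p : ℝ) ^ e = (1 / (p : ℝ)) ^ e := by
      rw [natCoe_apply, zeta_apply, if_neg (pow_ne_zero e hp.ne_zero)]; simp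
    have hs : Summable fun e : ℕ ↦ ‖(ζ : ArithmeticFunction ℝ) (p ^ e) / (p : ℝ) ^ e‖ := by
      simp_rw [h]
      exact (summable_geometric_of_lt_one (by positivity) hlt).norm
    obtain ⟨h1, h2⟩ := tsum_mul_prime_pow hp ih.1 hs
    rw [pow_succ]
    refine ⟨h1, ?_⟩
    rw [h2, ih.2]
    simp_rw [h]
    rw [tsum_geometric_of_lt_one (by positivity) hlt, pow_succ, mul_inv]

lemma summable_norm_tauRem_div {r a b : ℕ} (hr : 1 ≤ r) (ha : a ≠ 0) (hb : b ≠ 0) :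
    Summable fun n : ℕ ↦ ‖tauRem r a b n / n‖ := by
  refine Summable.of_nonneg_of_le (fun n ↦ norm_nonneg _) (fun n ↦ ?_)
    (summable_abs_tauRem_div_mul_log hr ha hb)
  rw [Real.norm_eq_abs, abs_div, Nat.abs_cast]
  exact le_mul_of_one_le_right (by positivity) (by linarith [Real.log_natCast_nonneg n])

lemma summable_norm_tauRem_prime_pow {r a b p : ℕ} (hr : 1 ≤ r) (ha : a ≠ 0) (hb : b ≠ 0)
    (hp : p.Prime) : Summable fun e : ℕ ↦ ‖tauRem r a b (p ^ e) / (p : ℝ) ^ e‖ := by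
  have h := (summable_norm_tauRem_div hr ha hb).comp_injective (Nat.pow_right_injective hp.two_le)
  exact h.congr fun e ↦ by simp

lemma tsum_tauRem_prime_pow {r a b p : ℕ} (hr : 1 ≤ r) (ha : a ≠ 0) (hb : b ≠ 0)
    (hp : p.Prime) : (Summable fun e : ℕ ↦ ‖tauShift r a b (p ^ e) / (p : ℝ) ^ e‖) ∧
    ∑' e : ℕ, tauRem r a b (p ^ e) / (p : ℝ) ^ e =
      (1 - 1 / (p : ℝ)) ^ (r ^ 2) * ∑' e : ℕ, tauShift r a b (p ^ e) / (p : ℝ) ^ e := by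
  have hp1 : (1 : ℝ) < p := by exact_mod_cast hp.one_lt
  have hlt : 1 / (p : ℝ) < 1 := by rw [div_lt_one (by linarith)]; exact hp1
  have hz := tsum_zeta_pow_prime_pow hp (r ^ 2)
  obtain ⟨h1, h2⟩ := tsum_mul_prime_pow hp hz.1 (summable_norm_tauRem_prime_pow hr ha hb hp)
  rw [zeta_pow_mul_tauRem] at h1 h2
  refine ⟨h1, ?_⟩
  rw [h2, hz.2, ← mul_assoc, mul_inv_cancel₀ (pow_ne_zero _ (by linarith)), one_mul]

lemma hasProd_tauRem {r a b : ℕ} (hr : 1 ≤ r) (ha : a ≠ 0) (hb : b ≠ 0) :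
    HasProd (fun p : Nat.Primes ↦ (1 - 1 / ((p : ℕ) : ℝ)) ^ (r ^ 2) *
      ∑' e : ℕ, tauShift r a b ((p : ℕ) ^ e) / ((p : ℕ) : ℝ) ^ e)
      (∑' n : ℕ, tauRem r a b n / n) := by
  have hm := isMultiplicative_tauRem hr ha hb
  have h := EulerProduct.eulerProduct_hasProd (f := fun n : ℕ ↦ tauRem r a b n / n)
    (by simp [hm.map_one]) (fun {m n} h ↦ by
      rw [hm.map_mul_of_coprime h, Nat.cast_mul, div_mul_div_comm])
    (summable_norm_tauRem_div hr ha hb) (by simp)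
  have he (p : Nat.Primes) : ∑' e : ℕ, tauRem r a b ((p : ℕ) ^ e) / (((p : ℕ) ^ e : ℕ) : ℝ) =
      (1 - 1 / ((p : ℕ) : ℝ)) ^ (r ^ 2) *
        ∑' e : ℕ, tauShift r a b ((p : ℕ) ^ e) / ((p : ℕ) : ℝ) ^ e := by
    rw [← (tsum_tauRem_prime_pow hr ha hb p.2).2]
    simp only [Nat.cast_pow]
  simp only [he] at h
  exact h

lemma tauShift_one_one (r n : ℕ) : tauShift r 1 1 n = (tauR r n : ℝ) ^ 2 := by
  simp [tauShift_apply, tauR_one, sq]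

lemma summable_tauR_sq {r p : ℕ} (hr : 1 ≤ r) (hp : p.Prime) :
    Summable fun e : ℕ ↦ (tauR r (p ^ e) : ℝ) ^ 2 / (p : ℝ) ^ e := by
  have := (tsum_tauRem_prime_pow hr one_ne_zero one_ne_zero hp).1.of_norm
  simpa only [tauShift_one_one] using this

lemma tsum_tauR_sq_pos {r p : ℕ} (hr : 1 ≤ r) (hp : p.Prime) :
    0 < ∑' e : ℕ, (tauR r (p ^ e) : ℝ) ^ 2 / (p : ℝ) ^ e := by
  refine (summable_tauR_sq hr hp).tsum_pos (fun e ↦ by positivity) 0 ?_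
  simp [tauR_one]

lemma constC2_eq_tsum {r : ℕ} (hr : 1 ≤ r) : constC2 r = ∑' n : ℕ, tauRem r 1 1 n / n := by
  rw [← (hasProd_tauRem hr one_ne_zero one_ne_zero).tprod_eq]
  simp only [tauShift_one_one]
  rfl

lemma hasProd_constC2 {r : ℕ} (hr : 1 ≤ r) :
    HasProd (fun p : Nat.Primes ↦ (1 - 1 / ((p : ℕ) : ℝ)) ^ (r ^ 2) *
      ∑' e : ℕ, (tauR r ((p : ℕ) ^ e) : ℝ) ^ 2 / ((p : ℕ) : ℝ) ^ e) (constC2 r) := by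
  rw [constC2_eq_tsum hr]
  simpa only [tauShift_one_one] using hasProd_tauRem hr one_ne_zero one_ne_zero

lemma constC2_ne_zero {r : ℕ} (hr : 1 ≤ r) : constC2 r ≠ 0 := by
  set x : Nat.Primes → ℝ := fun p ↦ (1 - 1 / ((p : ℕ) : ℝ)) ^ (r ^ 2) *
      ∑' e : ℕ, (tauR r ((p : ℕ) ^ e) : ℝ) ^ 2 / ((p : ℕ) : ℝ) ^ e with hx
  have hx0 (p : Nat.Primes) : x p ≠ 0 := by
    have hp1 : (1 : ℝ) < (p : ℕ) := by exact_mod_cast p.2.one_lt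
    have hlt : 1 / ((p : ℕ) : ℝ) < 1 := by rw [div_lt_one (by linarith)]; exact hp1
    exact mul_ne_zero (pow_ne_zero _ (by linarith)) (tsum_tauR_sq_pos hr p.2).ne'
  have hm := isMultiplicative_tauRem hr one_ne_zero one_ne_zero
  have hxs : Summable fun p ↦ ‖x p - 1‖ := by
    obtain ⟨h1, h2⟩ := summable_tauRem_primes hr one_ne_zero one_ne_zero
    refine Summable.of_nonneg_of_le (fun _ ↦ norm_nonneg _) (fun p ↦ ?_) h2
    have h3 := (tsum_tauRem_prime_pow hr one_ne_zero one_ne_zero p.2).2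
    have h4 := (summable_norm_tauRem_prime_pow hr one_ne_zero one_ne_zero p.2).of_norm
    simp only [tauShift_one_one] at h3
    rw [hx]
    beta_reduce
    rw [← h3, h4.tsum_eq_zero_add, pow_zero, pow_zero, hm.map_one, div_one, add_sub_cancel_left]
    refine tsum_of_norm_bounded ((summable_nat_add_iff 1).mpr (h1 p p.2)).hasSum fun e ↦ ?_
    have hpe : (1 : ℝ) ≤ (((p : ℕ) ^ (e + 1) : ℕ) : ℝ) := by
      exact_mod_cast Nat.pos_of_ne_zero (pow_ne_zero _ p.2.ne_zero)
    rw [norm_div, Real.norm_eq_abs, ← Nat.cast_pow, Real.norm_natCast, div_eq_mul_inv,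
      ← Real.rpow_neg_one]
    exact mul_le_mul_of_nonneg_left (Real.rpow_le_rpow_of_exponent_le hpe (by norm_num))
      (abs_nonneg _)
  have h := tprod_one_add_ne_zero_of_summable (f := fun p ↦ x p - 1) (by simpa using hx0) hxs
  simpa [constC2, hx] using h

/-- The Euler factor at `p` of `fTwo`, normalised by `τ_r(p^e)`, where `e = v_p(n)`. -/
noncomputable def fTwoFactor (r n p : ℕ) : ℝ :=
  (∑' j : ℕ, ((tauR r (p ^ (n.factorization p + j)) : ℝ) * tauR r (p ^ j)) / p ^ j) /
      (∑' j : ℕ, ((tauR r (p ^ j) : ℝ)) ^ 2 / p ^ j) / tauR r (p ^ n.factorization p)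

lemma fTwoFactor_eq_one {r n p : ℕ} (hr : 1 ≤ r) (hp : p.Prime) (h : n.factorization p = 0) :
    fTwoFactor r n p = 1 := by
  rw [fTwoFactor, h, pow_zero, tauR_one, Nat.cast_one, div_one]
  simp_rw [zero_add, ← sq]
  exact div_self (tsum_tauR_sq_pos hr hp).ne'

lemma hasProd_fTwoFactor {r n : ℕ} (hr : 1 ≤ r) (hn : n ≠ 0) :
    HasProd (fun p : Nat.Primes ↦ fTwoFactor r n p) (fTwo r n / tauR r n) := by
  have h1 : fTwo r n / tauR r n = ∏ p ∈ n.primeFactors, fTwoFactor r n p := by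
    rw [tauR_eq_prod r hn, fTwo, Nat.cast_prod, ← Finset.prod_div_distrib]
    rfl
  rw [h1, ← Finset.prod_subtype_of_mem (fTwoFactor r n) (p := Nat.Prime)
    fun p hp ↦ Nat.prime_of_mem_primeFactors hp]
  refine hasProd_prod_of_ne_finset_one fun p hp ↦ fTwoFactor_eq_one hr p.2 ?_
  rw [← Finsupp.notMem_support_iff, Nat.support_factorization]
  exact fun h ↦ hp (mem_subtype.mpr h)

lemma tsum_tauShift_prime_pow {r a b p : ℕ} (hr : 1 ≤ r) (ha : a ≠ 0) (hb : b ≠ 0)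
    (hab : a.Coprime b) (hp : p.Prime) :
    ∑' e : ℕ, tauShift r a b (p ^ e) / (p : ℝ) ^ e =
      (∑' e : ℕ, (tauR r (p ^ e) : ℝ) ^ 2 / (p : ℝ) ^ e) *
        (fTwoFactor r a p * fTwoFactor r b p) := by
  have hD := (tsum_tauR_sq_pos hr hp).ne'
  have h (c : ℕ) : (tauR r (p ^ c) : ℝ) ≠ 0 := by
    exact_mod_cast (tauR_pos hr (pow_ne_zero c hp.ne_zero)).ne'
  simp_rw [tauShift_prime_pow hr ha hb hp]
  have hor : b.factorization p = 0 ∨ a.factorization p = 0 := by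
    by_contra! hc
    have hpa := Nat.dvd_of_factorization_pos hc.2
    have hpb := Nat.dvd_of_factorization_pos hc.1
    exact hp.one_lt.ne' (Nat.dvd_one.mp (hab ▸ Nat.dvd_gcd hpa hpb))
  have key (c : ℕ) : (∑' e : ℕ, (tauR r (p ^ e) : ℝ) ^ 2 / (p : ℝ) ^ e) * fTwoFactor r c p =
      ∑' e : ℕ, (tauR r (p ^ (c.factorization p + e)) : ℝ) * tauR r (p ^ e) /
        tauR r (p ^ c.factorization p) / (p : ℝ) ^ e := by
    rw [fTwoFactor, div_right_comm, mul_div_cancel₀ _ hD, ← tsum_div_const]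
    exact tsum_congr fun e ↦ div_right_comm _ _ _
  rcases hor with h0 | h0
  · rw [fTwoFactor_eq_one hr hp h0, mul_one, key, h0]
    simp [tauR_one]
  · rw [fTwoFactor_eq_one hr hp h0, one_mul, key, h0]
    simp [tauR_one, mul_comm]

lemma tsum_tauRem_div {r a b : ℕ} (hr : 1 ≤ r) (ha : a ≠ 0) (hb : b ≠ 0) (hab : a.Coprime b) :
    ∑' n : ℕ, tauRem r a b n / n =
      constC2 r * (fTwo r a / tauR r a * (fTwo r b / tauR r b)) := by
  refine (hasProd_tauRem hr ha hb).unique ?_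
  convert (hasProd_constC2 hr).mul ((hasProd_fTwoFactor hr ha).mul (hasProd_fTwoFactor hr hb))
    using 2 with p
  rw [tsum_tauShift_prime_pow hr ha hb hab p.2, mul_assoc]

lemma fTwo_ne_zero {r n : ℕ} (hr : 1 ≤ r) : fTwo r n ≠ 0 := by
  refine prod_ne_zero_iff.mpr fun p hp ↦ ?_
  have hp' := Nat.prime_of_mem_primeFactors hp
  refine div_ne_zero ?_ (tsum_tauR_sq_pos hr hp').ne'
  have hn : n ≠ 0 := by rintro rfl; simp at hp
  have h (c : ℕ) : (0 : ℝ) < tauR r (p ^ c) := by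
    exact_mod_cast tauR_pos hr (pow_ne_zero c hp'.ne_zero)
  have hs := (tsum_tauRem_prime_pow hr hn one_ne_zero hp').1.of_norm.mul_right
    (tauR r (p ^ n.factorization p) : ℝ)
  have hs' : Summable fun j : ℕ ↦
      ((tauR r (p ^ (n.factorization p + j)) : ℝ) * tauR r (p ^ j)) / (p : ℝ) ^ j := by
    refine hs.congr fun j ↦ ?_
    rw [tauShift_prime_pow hr hn one_ne_zero hp']
    have := (h (n.factorization p)).ne'
    simp only [Nat.factorization_one, Finsupp.coe_zero, Pi.zero_apply, zero_add, pow_zero,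
      tauR_one, Nat.cast_one, mul_one]
    field_simp
  refine (hs'.tsum_pos (fun j ↦ by positivity) 0 ?_).ne'
  have := h (n.factorization p)
  have := h 0
  have := hp'.pos
  positivity

end EulerFactors

/-- Fix `r ∈ ℕ` and coprime `a, b ∈ ℕ`. Then
`Σ_{n ≤ x} τ_r(an) τ_r(bn)/n = C₂ f₂(a) f₂(b) ((log x)^{r²}/(r²)!) (1 + O(1/log x))`
as `x → ∞`. -/
theorem sum_tauR_mul_tauR_div (r a b : ℕ) (hr : 1 ≤ r) (ha : 1 ≤ a) (hb : 1 ≤ b)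
    (hab : Nat.Coprime a b) :
    (fun x : ℝ =>
        (∑ n ∈ Finset.Icc 1 ⌊x⌋₊, (tauR r (a * n) : ℝ) * tauR r (b * n) / n) -
          constC2 r * fTwo r a * fTwo r b * Real.log x ^ (r ^ 2) / (r ^ 2).factorial)
      =O[atTop] fun x : ℝ =>
        constC2 r * fTwo r a * fTwo r b * Real.log x ^ (r ^ 2) / (r ^ 2).factorial /
          Real.log x := by
  obtain ⟨m, hm⟩ := Nat.exists_eq_add_of_le' (Nat.one_le_pow 2 r hr)
  have ha0 : a ≠ 0 := by omega
  have hb0 : b ≠ 0 := by omega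
  have hta : (tauR r a : ℝ) ≠ 0 := by exact_mod_cast (tauR_pos hr ha0).ne'
  have htb : (tauR r b : ℝ) ≠ 0 := by exact_mod_cast (tauR_pos hr hb0).ne'
  have hmain := (isBigO_sum_zeta_pow_mul_div_sub m (tauRem r a b)
    (summable_abs_tauRem_div_mul_log hr ha0 hb0)).const_mul_left ((tauR r a : ℝ) * tauR r b)
  rw [← hm, zeta_pow_mul_tauRem, tsum_tauRem_div hr ha0 hb0 hab] at hmain
  have hc : constC2 r * fTwo r a * fTwo r b / (r ^ 2).factorial ≠ 0 :=
    div_ne_zero (mul_ne_zero (mul_ne_zero (constC2_ne_zero hr) (fTwo_ne_zero hr))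
      (fTwo_ne_zero hr)) (by exact_mod_cast (Nat.factorial_pos _).ne')
  refine ((Asymptotics.isBigO_const_mul_right_iff hc).mpr hmain).congr' ?_ ?_
  · refine Eventually.of_forall fun x ↦ ?_
    simp only [tauShift_apply]
    rw [mul_sub, mul_sum]
    congr 1
    · refine sum_congr rfl fun n _ ↦ ?_
      field_simp
    · field_simp
  · filter_upwards [eventually_gt_atTop 1] with x hx
    have := Real.log_pos hx
    rw [hm, pow_succ]
    field_simp
end

section
/- Fix k ∈ ℕ, k ≥ 1. Then Σ_{n ≤ x} Λ_k(n) = k x (log x)^{k−1} (1 + O(1/log x)) as x → ∞. -/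
open Filter Finset

/-- The `k`-th generalized von Mangoldt function `Λ_k = μ * log^k`, i.e.
`Λ_k(n) = Σ_{d | n} μ(d) (log(n/d))^k`. -/
noncomputable def vonMangoldtK (k n : ℕ) : ℝ :=
  ∑ d ∈ n.divisors, (ArithmeticFunction.moebius d : ℝ) * Real.log ((n : ℝ) / d) ^ k

namespace SumVonMangoldtK

/-- The difference `(s - 1) * (a^{-s} - ∫_a^{a+1} u^{-s} du)` with `a = n + 1`. -/
noncomputable def poleFreeTerm (n : ℕ) (s : ℂ) : ℂ :=
  (s - 1) * ((n + 1 : ℕ) : ℂ) ^ (-s) - ((n + 1 : ℕ) : ℂ) ^ (1 - s) + ((n + 2 : ℕ) : ℂ) ^ (1 - s)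

/-- The function `(s - 1) ζ(s)`, given by a series that converges for `0 < re s`. -/
noncomputable def poleFreeZeta (s : ℂ) : ℂ := 1 + ∑' n, poleFreeTerm n s

lemma hasDerivAt_ofReal_cpow {u : ℝ} (hu : 0 < u) (c : ℂ) :
    HasDerivAt (fun y : ℝ => (y : ℂ) ^ c) (c * (u : ℂ) ^ (c - 1)) u := by
  have h := (hasDerivAt_id (u : ℂ)).cpow_const (c := c)
    (Or.inl (by simpa using hu))
  simpa using h.comp_ofReal

lemma norm_cpow_neg_sub_le {s : ℂ} (hs : 0 < s.re) {a u : ℝ} (ha : 0 < a) (hau : a ≤ u) :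
    ‖(u : ℂ) ^ (-s) - (a : ℂ) ^ (-s)‖ ≤ ‖s‖ * a ^ (-s.re - 1) * (u - a) := by
  have := (convex_Icc a u).norm_image_sub_le_of_norm_hasDerivWithin_le
    (f := fun y : ℝ => (y : ℂ) ^ (-s)) (f' := fun y : ℝ => -s * (y : ℂ) ^ (-s - 1))
    (C := ‖s‖ * a ^ (-s.re - 1)) (x := a) (y := u)
    (fun y hy => (hasDerivAt_ofReal_cpow (ha.trans_le hy.1) (-s)).hasDerivWithinAt) ?_
    ⟨le_rfl, hau⟩ ⟨hau, le_rfl⟩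
  · rwa [Real.norm_of_nonneg (by linarith)] at this
  · intro y hy
    rw [norm_mul, norm_neg, Complex.norm_cpow_eq_rpow_re_of_pos (ha.trans_le hy.1)]
    gcongr ‖s‖ * ?_
    simpa using Real.rpow_le_rpow_of_nonpos ha hy.1 (by simp; linarith : (-s - 1).re ≤ 0)

lemma norm_poleFreeTerm_le {s : ℂ} (hs : 0 < s.re) (n : ℕ) :
    ‖poleFreeTerm n s‖ ≤ ‖s - 1‖ * ‖s‖ * ((n + 1 : ℕ) : ℝ) ^ (-s.re - 1) := by
  set a : ℝ := ((n + 1 : ℕ) : ℝ) with ha_def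
  have ha : 0 < a := by positivity
  have := (convex_Icc a (a + 1)).norm_image_sub_le_of_norm_hasDerivWithin_le
    (f := fun y : ℝ => (s - 1) * ((y : ℂ) - a) * (a : ℂ) ^ (-s) + (y : ℂ) ^ (1 - s))
    (f' := fun y : ℝ => (s - 1) * 1 * (a : ℂ) ^ (-s) + (1 - s) * (y : ℂ) ^ (1 - s - 1))
    (C := ‖s - 1‖ * ‖s‖ * a ^ (-s.re - 1)) (x := a) (y := a + 1)
    (fun y hy => HasDerivAt.hasDerivWithinAt (((((hasDerivAt_id (y : ℂ)).comp_ofReal.sub_const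
      (a : ℂ)).const_mul (s - 1)).mul_const _).add
      (hasDerivAt_ofReal_cpow (ha.trans_le hy.1) (1 - s)))) ?_
    ⟨le_rfl, by linarith⟩ ⟨by linarith, le_rfl⟩
  · have e : poleFreeTerm n s = (s - 1) * (((a + 1 : ℝ) : ℂ) - a) * (a : ℂ) ^ (-s)
        + ((a + 1 : ℝ) : ℂ) ^ (1 - s) - ((s - 1) * ((a : ℂ) - a) * (a : ℂ) ^ (-s)
        + (a : ℂ) ^ (1 - s)) := by
      rw [poleFreeTerm, ha_def]
      push_cast
      ring_nf
    rw [e]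
    simpa using this
  · intro y hy
    have e : (s - 1) * 1 * (a : ℂ) ^ (-s) + (1 - s) * (y : ℂ) ^ (1 - s - 1)
        = -((s - 1) * ((y : ℂ) ^ (-s) - (a : ℂ) ^ (-s))) := by
      rw [show 1 - s - 1 = -s by ring]; ring
    rw [e, norm_neg, norm_mul, mul_assoc]
    gcongr
    refine (norm_cpow_neg_sub_le hs ha hy.1).trans ?_
    have : y - a ≤ 1 := by linarith [hy.2]
    exact mul_le_of_le_one_right (by positivity) this

lemma summable_natCast_succ_rpow {p : ℝ} (hp : p < -1) :
    Summable fun n : ℕ => ((n + 1 : ℕ) : ℝ) ^ p :=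
  (summable_nat_add_iff 1).mpr (Real.summable_nat_rpow.mpr hp)

lemma summable_poleFreeTerm {s : ℂ} (hs : 0 < s.re) : Summable fun n => poleFreeTerm n s :=
  .of_norm_bounded ((summable_natCast_succ_rpow (by linarith)).mul_left _)
    (norm_poleFreeTerm_le hs)

lemma sum_range_poleFreeTerm (s : ℂ) (N : ℕ) :
    ∑ n ∈ range N, poleFreeTerm n s
      = (s - 1) * ∑ n ∈ range N, ((n + 1 : ℕ) : ℂ) ^ (-s) - 1 + ((N + 1 : ℕ) : ℂ) ^ (1 - s) := by
  induction N with
  | zero => simp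
  | succ N ih => rw [sum_range_succ, ih, sum_range_succ, poleFreeTerm]; ring

lemma poleFreeZeta_one : poleFreeZeta 1 = 1 := by
  simp [poleFreeZeta, poleFreeTerm]

lemma poleFreeZeta_eq {s : ℂ} (hs : 1 < s.re) : poleFreeZeta s = (s - 1) * riemannZeta s := by
  have h1 := (summable_poleFreeTerm (by linarith : 0 < s.re)).hasSum.tendsto_sum_nat
  simp_rw [sum_range_poleFreeTerm] at h1
  have h2 : Summable fun n : ℕ => ((n + 1 : ℕ) : ℂ) ^ (-s) := by
    refine .of_norm_bounded (summable_natCast_succ_rpow (p := -s.re) (by linarith)) fun n => ?_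
    rw [Complex.norm_natCast_cpow_of_pos (by positivity)]
    simp
  have h3 : Tendsto (fun N : ℕ => ((N + 1 : ℕ) : ℂ) ^ (1 - s)) atTop (nhds 0) := by
    rw [tendsto_zero_iff_norm_tendsto_zero]
    have : Tendsto (fun N : ℕ => (((N + 1 : ℕ) : ℝ)) ^ (-(s.re - 1))) atTop (nhds 0) :=
      (tendsto_rpow_neg_atTop (by linarith)).comp
        (tendsto_natCast_atTop_atTop.comp (tendsto_add_atTop_nat 1))
    refine this.congr fun N => ?_
    rw [Complex.norm_natCast_cpow_of_pos (by positivity)]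
    simp
  have h4 := ((h2.hasSum.tendsto_sum_nat.const_mul (s - 1)).sub_const 1).add h3
  have h5 := tendsto_nhds_unique h1 h4
  rw [poleFreeZeta, h5, zeta_eq_tsum_one_div_nat_add_one_cpow hs]
  simp [Complex.cpow_neg]

lemma differentiable_poleFreeTerm (n : ℕ) : Differentiable ℂ (poleFreeTerm n) := by
  unfold poleFreeTerm
  have (m : ℕ) (hm : m ≠ 0) (f : ℂ → ℂ) (hf : Differentiable ℂ f) :
      Differentiable ℂ fun s => (m : ℂ) ^ f s :=
    hf.const_cpow (Or.inl (by exact_mod_cast hm))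
  exact (((differentiable_id.sub_const 1).mul (this _ (by simp) _ differentiable_neg)).sub
    (this _ (by simp) _ (by fun_prop))).add (this _ (by simp) _ (by fun_prop))

lemma differentiableAt_poleFreeZeta {s : ℂ} (hs : 0 < s.re) :
    DifferentiableAt ℂ poleFreeZeta s := by
  set U : Set ℂ := {z | s.re / 2 < z.re} ∩ Metric.ball 0 (‖s‖ + 1)
  have hU : IsOpen U := (isOpen_lt continuous_const Complex.continuous_re).inter Metric.isOpen_ball
  have hsU : s ∈ U := ⟨by simp; linarith, by simp⟩
  have h := Complex.differentiableOn_tsum_of_summable_norm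
    (u := fun n : ℕ => (‖s‖ + 2) * (‖s‖ + 1) * ((n + 1 : ℕ) : ℝ) ^ (-(s.re / 2) - 1))
    (F := poleFreeTerm)
    ((summable_natCast_succ_rpow (by linarith)).mul_left _)
    (fun n => (differentiable_poleFreeTerm n).differentiableOn) hU ?_
  · exact ((h.differentiableAt (hU.mem_nhds hsU)).const_add 1)
  · intro n w hw
    have h1 : s.re / 2 < w.re := hw.1
    have h2 : ‖w‖ < ‖s‖ + 1 := by simpa using hw.2
    refine (norm_poleFreeTerm_le (by linarith) n).trans ?_
    have h3 : ‖w - 1‖ ≤ ‖s‖ + 2 := by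
      have := norm_sub_le w 1
      simp at this; linarith
    gcongr
    simp

lemma poleFreeZeta_eq_truncated {s : ℂ} (hs : 0 < s.re) (N : ℕ) :
    poleFreeZeta s = (s - 1) * ∑ n ∈ range N, ((n + 1 : ℕ) : ℂ) ^ (-s)
      + ((N + 1 : ℕ) : ℂ) ^ (1 - s) + ∑' n, poleFreeTerm (n + N) s := by
  rw [poleFreeZeta, ← (summable_poleFreeTerm hs).sum_add_tsum_nat_add N, sum_range_poleFreeTerm]
  ring

lemma sum_range_norm_cpow_neg_le {e : ℝ} (he : 0 < e) {s : ℂ} (hs : 1 - e ≤ s.re) {N : ℕ}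
    (hN : 1 ≤ N) :
    ‖∑ n ∈ range N, ((n + 1 : ℕ) : ℂ) ^ (-s)‖ ≤ (1 + 1 / e) * (N : ℝ) ^ (2 * e) := by
  have hN1 : (1 : ℝ) ≤ N := by exact_mod_cast hN
  have h1 : ‖∑ n ∈ range N, ((n + 1 : ℕ) : ℂ) ^ (-s)‖
      ≤ ∑ n ∈ range N, (N : ℝ) ^ e * ((n : ℝ) + 1)⁻¹ := by
    refine (norm_sum_le _ _).trans (sum_le_sum fun n hn => ?_)
    have hn' : n + 1 ≤ N := by simpa using hn
    rw [Complex.norm_natCast_cpow_of_pos (by positivity)]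
    calc ((n + 1 : ℕ) : ℝ) ^ (-s).re ≤ ((n + 1 : ℕ) : ℝ) ^ (e + (-1)) :=
          Real.rpow_le_rpow_of_exponent_le (by simp) (by simp; linarith)
      _ = ((n + 1 : ℕ) : ℝ) ^ e * ((n : ℝ) + 1)⁻¹ := by
          rw [Real.rpow_add (by positivity), Real.rpow_neg_one]; push_cast; rfl
      _ ≤ _ := by gcongr
  rw [← mul_sum] at h1
  have h2 : ∑ n ∈ range N, ((n : ℝ) + 1)⁻¹ ≤ 1 + Real.log N := by
    have := harmonic_le_one_add_log N
    rw [harmonic] at this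
    push_cast at this
    exact this
  have h3 : Real.log N ≤ (N : ℝ) ^ e / e := Real.log_le_rpow_div (by positivity) he
  have h4 : 1 ≤ (N : ℝ) ^ e := Real.one_le_rpow hN1 he.le
  calc _ ≤ (N : ℝ) ^ e * (1 + (N : ℝ) ^ e / e) := h1.trans (by gcongr; linarith)
    _ ≤ (N : ℝ) ^ e * ((N : ℝ) ^ e + (N : ℝ) ^ e / e) := by gcongr
    _ = _ := by rw [two_mul, Real.rpow_add (by positivity)]; ring

lemma norm_tsum_poleFreeTerm_le {e : ℝ} (he : e ≤ 1 / 4) {s : ℂ} (hs : 1 - e ≤ s.re) {N : ℕ}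
    (hN : 1 ≤ N) :
    ‖∑' n, poleFreeTerm (n + N) s‖
      ≤ ‖s - 1‖ * ‖s‖ * ((N : ℝ) ^ (-(1 / 2) : ℝ) * ∑' n : ℕ, ((n + 1 : ℕ) : ℝ) ^ (-(5 / 4) : ℝ)) := by
  have hN1 : (1 : ℝ) ≤ N := by exact_mod_cast hN
  rw [← tsum_mul_left, ← tsum_mul_left]
  refine tsum_of_norm_bounded
    (((summable_natCast_succ_rpow (by norm_num)).mul_left _).mul_left _).hasSum fun n => ?_
  refine (norm_poleFreeTerm_le (by linarith) _).trans ?_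
  gcongr
  have hp : (0 : ℝ) < ((n + N + 1 : ℕ) : ℝ) := by positivity
  calc ((n + N + 1 : ℕ) : ℝ) ^ (-s.re - 1)
      ≤ ((n + N + 1 : ℕ) : ℝ) ^ (-(1 / 2) + -(5 / 4) : ℝ) :=
        Real.rpow_le_rpow_of_exponent_le (by exact_mod_cast Nat.succ_le_succ (Nat.zero_le _))
          (by linarith)
    _ = ((n + N + 1 : ℕ) : ℝ) ^ (-(1 / 2) : ℝ) * ((n + N + 1 : ℕ) : ℝ) ^ (-(5 / 4) : ℝ) :=
        Real.rpow_add hp _ _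
    _ ≤ _ := by
        gcongr ?_ * ?_
        · exact Real.rpow_le_rpow_of_nonpos (by positivity) (by push_cast; linarith) (by norm_num)
        · exact Real.rpow_le_rpow_of_nonpos (by positivity) (by push_cast; linarith) (by norm_num)

lemma norm_le_two_mul_height {s : ℂ} (h0 : 0 ≤ s.re) (h4 : s.re ≤ 4) :
    ‖s‖ ≤ 2 * (|s.im| + 2) ∧ ‖s - 1‖ ≤ 2 * (|s.im| + 2) := by
  have h1 := Complex.norm_le_abs_re_add_abs_im s
  have h2 := Complex.norm_le_abs_re_add_abs_im (s - 1)
  simp only [Complex.sub_re, Complex.one_re, Complex.sub_im, Complex.one_im, sub_zero] at h2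
  have h3 : |s.re| ≤ 4 := abs_le.mpr ⟨by linarith, h4⟩
  have h5 : |s.re - 1| ≤ 3 := abs_le.mpr ⟨by linarith, by linarith⟩
  have := abs_nonneg s.im
  constructor <;> linarith

lemma exists_norm_poleFreeZeta_le {e : ℝ} (he : 0 < e) (he' : e ≤ 1 / 4) :
    ∃ C : ℝ, 0 < C ∧ ∀ s : ℂ, 1 - e ≤ s.re → s.re ≤ 4 →
      ‖poleFreeZeta s‖ ≤ C * (|s.im| + 2) ^ (1 + 4 * e) := by
  set S := ∑' n : ℕ, ((n + 1 : ℕ) : ℝ) ^ (-(5 / 4) : ℝ)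
  have hS : 0 ≤ S := tsum_nonneg fun n => by positivity
  refine ⟨10 * (1 + 1 / e) + 5 + 4 * S, by positivity, fun s h1 h4 => ?_⟩
  have hs : 0 < s.re := by linarith
  set W := |s.im| + 2 with hW
  have hW2 : 2 ≤ W := by have := abs_nonneg s.im; linarith
  obtain ⟨hn, hn1⟩ := norm_le_two_mul_height hs.le h4
  rw [← hW] at hn hn1
  set N := ⌈W⌉₊ ^ 2 with hN
  have hc1 : W ≤ ⌈W⌉₊ := Nat.le_ceil W
  have hc2 : (⌈W⌉₊ : ℝ) ≤ 2 * W := by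
    have := Nat.ceil_lt_add_one (by linarith : 0 ≤ W); linarith
  have hNW : W ^ 2 ≤ N := by rw [hN]; push_cast; gcongr
  have hNW' : (N : ℝ) + 1 ≤ 5 * W ^ 2 := by
    have : (N : ℝ) ≤ (2 * W) ^ 2 := by rw [hN]; push_cast; gcongr
    nlinarith
  have hN1 : 1 ≤ N := by
    have : (1 : ℝ) ≤ N := by nlinarith
    exact_mod_cast this
  have hpow : (5 * W ^ 2) ^ (2 * e) ≤ 5 * W ^ (4 * e) := by
    rw [Real.mul_rpow (by norm_num) (by positivity), ← Real.rpow_natCast, ← Real.rpow_mul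
      (by linarith)]
    rw [show ((2 : ℕ) : ℝ) * (2 * e) = 4 * e by push_cast; ring]
    gcongr
    calc (5 : ℝ) ^ (2 * e) ≤ 5 ^ (1 : ℝ) :=
          Real.rpow_le_rpow_of_exponent_le (by norm_num) (by linarith)
      _ = 5 := by norm_num
  have hWe : W * W ^ (4 * e) = W ^ (1 + 4 * e) := by
    rw [Real.rpow_add (by linarith), Real.rpow_one]
  have hWe1 : 1 ≤ W ^ (4 * e) := Real.one_le_rpow (by linarith) (by linarith)
  rw [poleFreeZeta_eq_truncated hs N]
  have t1 : ‖(s - 1) * ∑ n ∈ range N, ((n + 1 : ℕ) : ℂ) ^ (-s)‖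
      ≤ (2 * W) * ((1 + 1 / e) * (5 * W ^ (4 * e))) := by
    rw [norm_mul]
    gcongr
    refine (sum_range_norm_cpow_neg_le he h1 hN1).trans ?_
    gcongr
    refine le_trans ?_ hpow
    gcongr
    linarith
  have t2 : ‖((N + 1 : ℕ) : ℂ) ^ (1 - s)‖ ≤ 5 * W ^ (4 * e) := by
    rw [Complex.norm_natCast_cpow_of_pos (by positivity)]
    calc ((N + 1 : ℕ) : ℝ) ^ (1 - s).re ≤ ((N + 1 : ℕ) : ℝ) ^ (2 * e) :=
          Real.rpow_le_rpow_of_exponent_le (by simp) (by simp; linarith)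
      _ ≤ (5 * W ^ 2) ^ (2 * e) := by gcongr; exact_mod_cast hNW'
      _ ≤ _ := hpow
  have t3 : ‖∑' n, poleFreeTerm (n + N) s‖ ≤ (2 * W) * (2 * W) * (W⁻¹ * S) := by
    refine (norm_tsum_poleFreeTerm_le he' h1 hN1).trans ?_
    gcongr
    calc (N : ℝ) ^ (-(1 / 2) : ℝ) ≤ (W ^ 2) ^ (-(1 / 2) : ℝ) :=
          Real.rpow_le_rpow_of_nonpos (by positivity) hNW (by norm_num)
      _ = W⁻¹ := by
          rw [← Real.rpow_natCast, ← Real.rpow_mul (by linarith), ← Real.rpow_neg_one]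
          norm_num
  refine (norm_add₃_le).trans ((add_le_add_three t1 t2 t3).trans ?_)
  have e3 : (2 * W) * (2 * W) * (W⁻¹ * S) = 4 * S * W := by field_simp; ring
  have t4 : W ≤ W ^ (1 + 4 * e) := by rw [← hWe]; nlinarith
  have t5 : W ^ (4 * e) ≤ W ^ (1 + 4 * e) := by rw [← hWe]; nlinarith
  calc _ = 10 * (1 + 1 / e) * W ^ (1 + 4 * e) + 5 * W ^ (4 * e) + 4 * S * W := by
        rw [e3, ← hWe]; ring
    _ ≤ 10 * (1 + 1 / e) * W ^ (1 + 4 * e) + 5 * W ^ (1 + 4 * e) + 4 * S * W ^ (1 + 4 * e) := by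
        gcongr
    _ = _ := by ring

/-- Cauchy's estimate for functions of polynomial growth in a vertical strip. -/
lemma exists_norm_iteratedDeriv_le {f : ℂ → ℂ} (hf : ∀ s : ℂ, 0 < s.re → DifferentiableAt ℂ f s)
    {e p C : ℝ} (he : 0 < e) (he' : e ≤ 1 / 4) (hp : 0 ≤ p)
    (hC : ∀ s : ℂ, 1 - e ≤ s.re → s.re ≤ 4 → ‖f s‖ ≤ C * (|s.im| + 2) ^ p) (i : ℕ) :
    ∃ C' : ℝ, 0 < C' ∧ ∀ s : ℂ, 1 ≤ s.re → s.re ≤ 2 →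
      ‖iteratedDeriv i f s‖ ≤ C' * (|s.im| + 2) ^ p := by
  refine ⟨i.factorial * ((|C| + 1) * 2 ^ p) / e ^ i, by positivity, fun s h1 h2 => ?_⟩
  have hball : ∀ z ∈ Metric.closedBall s e, |z.re - s.re| ≤ e ∧ |z.im - s.im| ≤ e := by
    intro z hz
    rw [mem_closedBall_iff_norm] at hz
    exact ⟨(by simpa using Complex.abs_re_le_norm (z - s) : _ ≤ ‖z - s‖).trans hz,
      (by simpa using Complex.abs_im_le_norm (z - s) : _ ≤ ‖z - s‖).trans hz⟩
  have hd : DiffContOnCl ℂ f (Metric.ball s e) := by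
    refine DifferentiableOn.diffContOnCl fun z hz => ?_
    have := (abs_le.mp (hball z (Metric.closure_ball_subset_closedBall hz)).1).1
    exact (hf z (by linarith)).differentiableWithinAt
  have hW : 0 ≤ |s.im| := abs_nonneg _
  have := Complex.norm_iteratedDeriv_le_of_forall_mem_sphere_norm_le i he hd
    (C := (|C| + 1) * 2 ^ p * (|s.im| + 2) ^ p) (fun z hz => ?_)
  · refine this.trans (le_of_eq ?_)
    ring
  · obtain ⟨hz1, hz2⟩ := hball z (Metric.sphere_subset_closedBall hz)
    have hz1' := abs_le.mp hz1
    have hz3 : |z.im| + 2 ≤ 2 * (|s.im| + 2) := by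
      have := abs_sub_abs_le_abs_sub z.im s.im
      linarith
    refine (hC z (by linarith) (by linarith)).trans ?_
    rw [mul_assoc, ← Real.mul_rpow (by norm_num) (by linarith)]
    gcongr
    linarith [le_abs_self C]

lemma exists_norm_dslope_poleFreeZeta_le {e : ℝ} (he : 0 < e) (he' : e ≤ 1 / 4) :
    ∃ C : ℝ, ∀ s : ℂ, 1 - e ≤ s.re → s.re ≤ 4 →
      ‖dslope poleFreeZeta 1 s‖ ≤ C * (|s.im| + 2) ^ (4 * e) := by
  obtain ⟨C, hC0, hC⟩ := exists_norm_poleFreeZeta_le he he'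
  have hcont : ContinuousOn (dslope poleFreeZeta 1) (Metric.closedBall 1 (1 / 2)) := by
    refine DifferentiableOn.continuousOn (𝕜 := ℂ) ?_
    rw [Complex.differentiableOn_dslope (Metric.closedBall_mem_nhds _ (by norm_num))]
    intro z hz
    refine (differentiableAt_poleFreeZeta ?_).differentiableWithinAt
    rw [mem_closedBall_iff_norm] at hz
    have := (abs_le.mp ((Complex.abs_re_le_norm (z - 1)).trans hz)).1
    simp at this; linarith
  obtain ⟨B, hB⟩ := (isCompact_closedBall (1 : ℂ) (1 / 2)).exists_bound_of_continuousOn hcont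
  refine ⟨|B| + 5 * (C + 1), fun s h1 h4 => ?_⟩
  have hW := abs_nonneg s.im
  have hWe1 : 1 ≤ (|s.im| + 2) ^ (4 * e) := Real.one_le_rpow (by linarith) (by linarith)
  rcases le_or_gt ‖s - 1‖ (1 / 2) with h | h
  · have := hB s (by rwa [mem_closedBall_iff_norm])
    calc _ ≤ (|B| + 5 * (C + 1)) * 1 := by linarith [le_abs_self B]
      _ ≤ _ := by gcongr
  · have hne : s ≠ 1 := by rintro rfl; norm_num at h
    have him : |s.im| ≤ ‖s - 1‖ := by simpa using Complex.abs_im_le_norm (s - 1)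
    rw [dslope_of_ne _ hne, slope_def_field, poleFreeZeta_one, norm_div, div_le_iff₀ (by linarith)]
    calc ‖poleFreeZeta s - 1‖ ≤ C * (|s.im| + 2) ^ (1 + 4 * e) + 1 := by
          refine (norm_sub_le _ _).trans ?_
          simpa using hC s h1 h4
      _ = C * ((|s.im| + 2) * (|s.im| + 2) ^ (4 * e)) + 1 := by
          rw [Real.rpow_add (by linarith), Real.rpow_one]
      _ ≤ (C + 1) * ((|s.im| + 2) * (|s.im| + 2) ^ (4 * e)) := by nlinarith
      _ ≤ (C + 1) * ((5 * ‖s - 1‖) * (|s.im| + 2) ^ (4 * e)) := by gcongr; linarith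
      _ = 5 * (C + 1) * (|s.im| + 2) ^ (4 * e) * ‖s - 1‖ := by ring
      _ ≤ _ := by gcongr; linarith [abs_nonneg B]

lemma le_norm_poleFreeZeta_product {x : ℝ} (hx : 0 < x) (y : ℝ) :
    x ^ 3 * ‖(x + Complex.I * y : ℂ)‖ ^ 4 * ‖(x + 2 * Complex.I * y : ℂ)‖ ≤
      ‖poleFreeZeta (1 + x)‖ ^ 3 * ‖poleFreeZeta (1 + x + Complex.I * y)‖ ^ 4
        * ‖poleFreeZeta (1 + x + 2 * Complex.I * y)‖ := by
  have h := DirichletCharacter.norm_LFunction_product_ge_one (1 : DirichletCharacter ℂ 1) hx y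
  rw [DirichletCharacter.LFunctionTrivChar, DirichletCharacter.LFunction_modOne_eq,
    DirichletCharacter.LFunction_modOne_eq] at h
  rw [poleFreeZeta_eq (by simpa), poleFreeZeta_eq (by simpa), poleFreeZeta_eq (by simpa)]
  simp only [norm_mul, norm_pow] at h ⊢
  have e0 : ‖(1 + x - 1 : ℂ)‖ = x := by simp [abs_of_pos hx]
  have e1 : (1 + x + Complex.I * y - 1 : ℂ) = x + Complex.I * y := by ring
  have e2 : (1 + x + 2 * Complex.I * y - 1 : ℂ) = x + 2 * Complex.I * y := by ring
  rw [e0, e1, e2]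
  calc _ = x ^ 3 * ‖(x + Complex.I * y : ℂ)‖ ^ 4 * ‖(x + 2 * Complex.I * y : ℂ)‖ * 1 := by ring
    _ ≤ _ := mul_le_mul_of_nonneg_left h (by positivity)
    _ = _ := by ring

lemma norm_poleFreeZeta_sub_le {C p : ℝ}
    (hC : ∀ s : ℂ, 1 ≤ s.re → s.re ≤ 2 → ‖deriv poleFreeZeta s‖ ≤ C * (|s.im| + 2) ^ p)
    {y x t : ℝ} (hy : 1 ≤ y) (hyx : y ≤ x) (hx : x ≤ 2) :
    ‖poleFreeZeta (x + Complex.I * t) - poleFreeZeta (y + Complex.I * t)‖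
      ≤ C * (|t| + 2) ^ p * (x - y) := by
  have := (convex_Icc y x).norm_image_sub_le_of_norm_hasDerivWithin_le
    (f := fun u : ℝ => poleFreeZeta (u + Complex.I * t))
    (f' := fun u : ℝ => deriv poleFreeZeta (u + Complex.I * t))
    (C := C * (|t| + 2) ^ p) (x := y) (y := x) ?_ ?_ ⟨le_rfl, hyx⟩ ⟨hyx, le_rfl⟩
  · rwa [Real.norm_of_nonneg (by linarith)] at this
  · intro u hu
    have h0 : 0 < (u + Complex.I * t : ℂ).re := by simp; linarith [hu.1]
    have h1 := (differentiableAt_poleFreeZeta h0).hasDerivAt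
    have h2 := (HasDerivAt.comp (u : ℂ) (h₂ := poleFreeZeta) h1
      ((hasDerivAt_id (u : ℂ)).add_const (Complex.I * t))).comp_ofReal
    simpa using h2.hasDerivWithinAt
  · intro u hu
    simpa using hC (u + Complex.I * t) (by simp; linarith [hu.1]) (by simp; linarith [hu.2])

lemma exists_le_norm_poleFreeZeta {e : ℝ} (he : 0 < e) (he' : e ≤ 1 / 4) :
    ∃ c : ℝ, 0 < c ∧ ∀ s : ℂ, 1 < s.re → s.re ≤ 2 →
      c * (|s.im| + 2) * ((|s.im| + 2) ^ (-(4 * e))) ^ 4 ≤ ‖poleFreeZeta s‖ := by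
  obtain ⟨C₀, hC₀, hZ⟩ := exists_norm_poleFreeZeta_le he he'
  obtain ⟨C₁, hC₁, hZ'⟩ := exists_norm_iteratedDeriv_le
    (fun s hs => differentiableAt_poleFreeZeta hs) he he' (by linarith) hZ 1
  simp only [iteratedDeriv_one] at hZ'
  obtain ⟨r, hr, hρ⟩ : ∃ r > 0, ∀ s : ℂ, ‖s - 1‖ < r → 1 / 2 < ‖poleFreeZeta s‖ := by
    have hc : ContinuousAt (fun s => ‖poleFreeZeta s‖) 1 :=
      (differentiableAt_poleFreeZeta (by simp)).continuousAt.norm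
    have := hc.eventually (lt_mem_nhds (by simp [poleFreeZeta_one]; norm_num :
      (1 / 2 : ℝ) < ‖poleFreeZeta 1‖))
    obtain ⟨r, hr, h⟩ := Metric.eventually_nhds_iff.mp this
    exact ⟨r, hr, fun s hs => h (by rwa [dist_eq_norm])⟩
  set ρ := min (r / 2) (1 / 2)
  have hρ0 : 0 < ρ := by positivity
  have hρr : 2 * ρ ≤ r := by linarith [min_le_left (r / 2) (1 / 2 : ℝ)]
  have hρ1 : ρ ≤ 1 / 2 := min_le_right _ _
  set K := 1 + 2 / ρ with hK
  have hK0 : 0 < K := by positivity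
  set B := (4 * C₀) ^ 4 with hB
  set η := min ρ (1 / (K ^ 5 * B) / (16 * C₁ ^ 4)) with hη
  have hη0 : 0 < η := by positivity
  have hηρ : η ≤ ρ := min_le_left _ _
  have hη1 : η * (16 * C₁ ^ 4) * (K ^ 5 * B) ≤ 1 := by
    have := min_le_right ρ (1 / (K ^ 5 * B) / (16 * C₁ ^ 4))
    rw [← hη, le_div_iff₀ (by positivity), le_div_iff₀ (by positivity)] at this
    exact this
  refine ⟨min (1 / 6) (η * C₁), by positivity, fun s hs1 hs2 => ?_⟩
  set t := s.im with ht
  set W := |t| + 2 with hW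
  have hW2 : 2 ≤ W := by have := abs_nonneg t; linarith
  set v := W ^ (-(4 * e)) with hv
  have hv0 : 0 < v := by positivity
  have hv1 : v ≤ 1 := Real.rpow_le_one_of_one_le_of_nonpos (by linarith) (by linarith)
  have hWp : W ^ (1 + 4 * e) = W / v := by
    rw [hv, Real.rpow_neg (by linarith), Real.rpow_add (by linarith), Real.rpow_one]; simp
  have hse : s = (s.re : ℂ) + Complex.I * t := by
    rw [mul_comm]; exact (Complex.re_add_im s).symm
  have hsn : ‖s - 1‖ ≤ (s.re - 1) + |t| := by
    have := Complex.norm_le_abs_re_add_abs_im (s - 1)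
    simpa [abs_of_pos (by linarith : 0 < s.re - 1)] using this
  have hst : |t| ≤ ‖s - 1‖ := by simpa using Complex.abs_im_le_norm (s - 1)
  rcases lt_or_ge ‖s - 1‖ (2 * ρ) with h | h
  · have h1 := hρ s (h.trans_le hρr)
    have hv4 : v ^ 4 ≤ 1 := pow_le_one₀ hv0.le hv1
    calc _ ≤ 1 / 6 * 3 * (1 : ℝ) := by gcongr; exacts [min_le_left _ _, by linarith]
      _ ≤ _ := by linarith
  · set x := max (s.re - 1) (η * v ^ 5)
    have hxy : s.re - 1 ≤ x := le_max_left _ _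
    have hxη : η * v ^ 5 ≤ x := le_max_right _ _
    have hηv : η * v ^ 5 ≤ ρ := by
      calc _ ≤ ρ * 1 := by gcongr; exact pow_le_one₀ hv0.le hv1
        _ = ρ := mul_one _
    have hx0 : 0 < x := by linarith
    have hx1 : x ≤ 1 := max_le (by linarith) (by linarith)
    have hxd : x - (s.re - 1) ≤ η * v ^ 5 := by
      rw [sub_le_iff_le_add]
      exact max_le (by nlinarith [pow_pos hv0 5]) (by linarith)
    have ex : (x + Complex.I * t : ℂ).re = x := by simp
    have et : (x + Complex.I * t : ℂ).im = t := by simp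
    have hxt : |t| ≤ ‖(x + Complex.I * t : ℂ)‖ := by
      simpa using Complex.abs_im_le_norm (x + Complex.I * t : ℂ)
    have hxx : x ≤ ‖(x + Complex.I * t : ℂ)‖ := by
      have := Complex.abs_re_le_norm (x + Complex.I * t : ℂ)
      rw [ex] at this
      exact (le_abs_self x).trans this
    have hnρ : ρ ≤ ‖(x + Complex.I * t : ℂ)‖ := by
      rcases max_choice (s.re - 1) (η * v ^ 5) with h' | h'
      · have : (x + Complex.I * t : ℂ) = s - 1 := by
          rw [hse]; simp only [x, h']; push_cast; ring
        rw [this]; linarith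
      · have : x ≤ ρ := (le_of_eq h').trans hηv
        linarith
    have hWK : W ≤ K * ‖(x + Complex.I * t : ℂ)‖ := by
      have : 2 ≤ 2 / ρ * ‖(x + Complex.I * t : ℂ)‖ := by
        rw [div_mul_eq_mul_div, le_div_iff₀ hρ0]; linarith
      rw [hK, add_mul, one_mul]; linarith
    have hn2 : ‖(x + Complex.I * t : ℂ)‖ ≤ ‖(x + 2 * Complex.I * t : ℂ)‖ := by
      rw [Complex.norm_def, Complex.norm_def]
      apply Real.sqrt_le_sqrt
      simp [Complex.normSq_apply]
      nlinarith [sq_nonneg t]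
    have hprod := le_norm_poleFreeZeta_product hx0 t
    have hp2 : (2 : ℝ) ^ (1 + 4 * e) ≤ 4 := by
      calc (2 : ℝ) ^ (1 + 4 * e) ≤ 2 ^ (2 : ℝ) :=
            Real.rpow_le_rpow_of_exponent_le (by norm_num) (by linarith)
        _ = 4 := by norm_num
    have b1 : ‖poleFreeZeta (1 + x)‖ ≤ 4 * C₀ := by
      have := hZ (1 + x) (by simp; linarith) (by simp; linarith)
      simp only [Complex.add_im, Complex.one_im, Complex.ofReal_im, add_zero, abs_zero,
        zero_add] at this
      nlinarith
    have b2 : ‖poleFreeZeta (1 + x + 2 * Complex.I * t)‖ ≤ 4 * C₀ * (W / v) := by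
      have := hZ (1 + x + 2 * Complex.I * t) (by simp; linarith) (by simp; linarith)
      have e1 : (1 + x + 2 * Complex.I * t : ℂ).im = 2 * t := by simp
      rw [e1, abs_mul, abs_two] at this
      refine this.trans ?_
      calc C₀ * (2 * |t| + 2) ^ (1 + 4 * e) ≤ C₀ * (2 * W) ^ (1 + 4 * e) := by
            gcongr; linarith
        _ = C₀ * (2 ^ (1 + 4 * e) * (W / v)) := by
            rw [Real.mul_rpow (by norm_num) (by linarith), hWp]
        _ ≤ C₀ * (4 * (W / v)) := by gcongr
        _ = _ := by ring
    set Y := ‖poleFreeZeta (1 + x + Complex.I * t)‖ with hY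
    have hY0 : 0 ≤ Y := norm_nonneg _
    have h5 : (η * v ^ 5) ^ 3 * (W / K) ^ 5 ≤ B * Y ^ 4 * (W / v) := by
      have hWK' : W / K ≤ ‖(x + Complex.I * t : ℂ)‖ := by
        rw [div_le_iff₀ hK0]; linarith
      calc (η * v ^ 5) ^ 3 * (W / K) ^ 5
          = (η * v ^ 5) ^ 3 * (W / K) ^ 4 * (W / K) := by ring
        _ ≤ x ^ 3 * ‖(x + Complex.I * t : ℂ)‖ ^ 4 * ‖(x + 2 * Complex.I * t : ℂ)‖ := by
            gcongr
            exact hWK'.trans hn2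
        _ ≤ _ := hprod
        _ ≤ (4 * C₀) ^ 3 * Y ^ 4 * (4 * C₀ * (W / v)) := by gcongr
        _ = _ := by rw [hB]; ring
    have h6 : (η ^ 3 * v ^ 16 * W ^ 4) ≤ K ^ 5 * B * Y ^ 4 := by
      have e1 : (η * v ^ 5) ^ 3 * (W / K) ^ 5
          = (η ^ 3 * v ^ 16 * W ^ 4) * (W / v) / K ^ 5 := by field_simp
      rw [e1, div_le_iff₀ (by positivity)] at h5
      refine le_of_mul_le_mul_right (h5.trans (le_of_eq ?_)) (by positivity : 0 < W / v)
      ring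
    have h7 : 2 * (η * C₁ * v ^ 4 * W) ≤ Y := by
      refine le_of_pow_le_pow_left₀ (n := 4) (by norm_num) hY0 ?_
      refine le_of_mul_le_mul_left ?_ (by positivity : 0 < K ^ 5 * B)
      refine le_trans ?_ h6
      calc K ^ 5 * B * (2 * (η * C₁ * v ^ 4 * W)) ^ 4
          = (η * (16 * C₁ ^ 4) * (K ^ 5 * B)) * (η ^ 3 * v ^ 16 * W ^ 4) := by ring
        _ ≤ 1 * (η ^ 3 * v ^ 16 * W ^ 4) := by gcongr
        _ = _ := one_mul _
    have h8 := norm_poleFreeZeta_sub_le hZ' (t := t) hs1.le (x := 1 + x) (by linarith)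
      (by linarith)
    rw [← hse, hWp] at h8
    have h9 : C₁ * (W / v) * (1 + x - s.re) ≤ η * C₁ * v ^ 4 * W := by
      calc _ ≤ C₁ * (W / v) * (η * v ^ 5) := by gcongr; linarith
        _ = _ := by field_simp
    have h10 : Y ≤ ‖poleFreeZeta s‖ + η * C₁ * v ^ 4 * W := by
      have := norm_le_norm_add_norm_sub' (poleFreeZeta (1 + x + Complex.I * t)) (poleFreeZeta s)
      push_cast at h8
      linarith
    calc _ ≤ η * C₁ * W * v ^ 4 := by gcongr; exact min_le_right _ _
      _ ≤ _ := by linarith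

lemma exists_norm_iteratedDeriv_logDeriv_le (j : ℕ) :
    ∃ M : ℝ, 0 < M ∧ ∀ (f : ℂ → ℂ) (z : ℂ) (B : ℝ), AnalyticAt ℂ f z → f z ≠ 0 → 1 ≤ B →
      (∀ i ≤ j + 1, ‖iteratedDeriv i f z‖ ≤ B * ‖f z‖) →
      ‖iteratedDeriv j (logDeriv f) z‖ ≤ M * B ^ (j + 1) := by
  induction j using Nat.strong_induction_on with
  | _ j ih =>
  choose! M hM0 hM using ih
  refine ⟨1 + ∑ i ∈ range j, j.choose i * M i, ?_, fun f z B hf hz hB h => ?_⟩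
  · have : 0 ≤ ∑ i ∈ range j, j.choose i * M i :=
      sum_nonneg fun i hi => mul_nonneg (by positivity) (hM0 i (mem_range.mp hi)).le
    linarith
  have hfz : 0 < ‖f z‖ := norm_pos_iff.mpr hz
  have hL : AnalyticAt ℂ (logDeriv f) z := hf.deriv.div hf hz
  have hev : logDeriv f * f =ᶠ[nhds z] deriv f := by
    filter_upwards [hf.continuousAt.eventually_ne hz] with w hw
    simp [logDeriv, hw]
  have h1 := hev.iteratedDeriv_eq j
  rw [← iteratedDeriv_succ', iteratedDeriv_mul hL.contDiffAt hf.contDiffAt, sum_range_succ] at h1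
  simp only [Nat.choose_self, Nat.cast_one, one_mul, Nat.sub_self, iteratedDeriv_zero] at h1
  have h2 : iteratedDeriv j (logDeriv f) z * f z = iteratedDeriv (j + 1) f z
      - ∑ i ∈ range j, j.choose i * iteratedDeriv i (logDeriv f) z * iteratedDeriv (j - i) f z := by
    rw [← h1]; ring
  have h3 : ‖∑ i ∈ range j, (j.choose i : ℂ) * iteratedDeriv i (logDeriv f) z
      * iteratedDeriv (j - i) f z‖ ≤ ∑ i ∈ range j, (j.choose i * M i) * (B ^ (j + 1) * ‖f z‖) := by
    refine (norm_sum_le _ _).trans (sum_le_sum fun i hi => ?_)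
    have hij := mem_range.mp hi
    have h4 := hM i hij f z B hf hz hB fun l hl => h l (by omega)
    have h5 := h (j - i) (by omega)
    rw [norm_mul, norm_mul, Complex.norm_natCast]
    calc _ ≤ (j.choose i : ℝ) * (M i * B ^ (i + 1)) * (B * ‖f z‖) := by
          have := (hM0 i hij).le
          gcongr
      _ = (j.choose i * M i) * (B ^ (i + 2) * ‖f z‖) := by ring
      _ ≤ _ := by
          have := (hM0 i hij).le
          have := pow_le_pow_right₀ hB (by omega : i + 2 ≤ j + 1)
          gcongr
  rw [← sum_mul] at h3
  refine le_of_mul_le_mul_right ?_ hfz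
  rw [← norm_mul, h2]
  refine (norm_sub_le _ _).trans ?_
  have h6 : ‖iteratedDeriv (j + 1) f z‖ ≤ B ^ (j + 1) * ‖f z‖ :=
    (h (j + 1) le_rfl).trans (by gcongr; exact le_self_pow₀ hB (by omega))
  linarith

/-- The weighted deviation `(Λ(n) - 1) (log n)^4`. -/
noncomputable def weightedDeviation (n : ℕ) : ℝ :=
  (ArithmeticFunction.vonMangoldt n - 1) * Real.log n ^ 4

lemma iterate_logMul (f : ℕ → ℂ) (m n : ℕ) :
    LSeries.logMul^[m] f n = Complex.log n ^ m * f n := by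
  induction m generalizing f with
  | zero => simp
  | succ m ih => rw [Function.iterate_succ_apply, ih, LSeries.logMul]; ring

lemma ofReal_weightedDeviation : (fun n => (weightedDeviation n : ℂ)) =
    LSeries.logMul^[4] ((fun n => (ArithmeticFunction.vonMangoldt n : ℂ)) - 1) := by
  ext n
  rw [iterate_logMul, weightedDeviation, ← Complex.natCast_log]
  simp only [Pi.sub_apply, Pi.one_apply]
  push_cast
  ring

lemma LSeriesSummable_vonMangoldt_sub_one {s : ℂ} (hs : 1 < s.re) :
    LSeriesSummable ((fun n => (ArithmeticFunction.vonMangoldt n : ℂ)) - 1) s :=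
  (ArithmeticFunction.LSeriesSummable_vonMangoldt hs).sub (LSeriesSummable_one_iff.mpr hs)

lemma abscissaOfAbsConv_vonMangoldt_sub_one_lt {s : ℂ} (hs : 1 < s.re) :
    LSeries.abscissaOfAbsConv ((fun n => (ArithmeticFunction.vonMangoldt n : ℂ)) - 1) < s.re := by
  refine lt_of_le_of_lt (LSeries.abscissaOfAbsConv_le_of_forall_lt_LSeriesSummable (x := 1)
    fun y hy => LSeriesSummable_vonMangoldt_sub_one (by simpa using hy)) ?_
  exact_mod_cast hs

lemma LSeriesSummable_weightedDeviation {s : ℂ} (hs : 1 < s.re) :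
    LSeriesSummable (fun n => (weightedDeviation n : ℂ)) s := by
  rw [ofReal_weightedDeviation]
  refine LSeriesSummable_of_abscissaOfAbsConv_lt_re ?_
  rw [LSeries.absicssaOfAbsConv_logPowMul]
  exact abscissaOfAbsConv_vonMangoldt_sub_one_lt hs

lemma poleFreeZeta_ne_zero {s : ℂ} (hs : 1 < s.re) : poleFreeZeta s ≠ 0 := by
  rw [poleFreeZeta_eq hs]
  refine mul_ne_zero (fun h => ?_) (riemannZeta_ne_zero_of_one_lt_re hs)
  rw [sub_eq_zero.mp h] at hs
  simp at hs

lemma LSeries_vonMangoldt_sub_one_eq {s : ℂ} (hs : 1 < s.re) :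
    LSeries ((fun n => (ArithmeticFunction.vonMangoldt n : ℂ)) - 1) s
      = -logDeriv poleFreeZeta s - dslope poleFreeZeta 1 s := by
  have hs1 : s ≠ 1 := by rintro rfl; simp at hs
  have hs1' : s - 1 ≠ 0 := sub_ne_zero.mpr hs1
  have hζ := riemannZeta_ne_zero_of_one_lt_re hs
  have hev : poleFreeZeta =ᶠ[nhds s] fun z => (z - 1) * riemannZeta z := by
    filter_upwards [(isOpen_lt continuous_const Complex.continuous_re).mem_nhds hs] with z hz
    exact poleFreeZeta_eq hz
  have hd : deriv poleFreeZeta s = 1 * riemannZeta s + (s - 1) * deriv riemannZeta s := by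
    rw [hev.deriv_eq]
    exact (((hasDerivAt_id s).sub_const 1).mul (differentiableAt_riemannZeta hs1).hasDerivAt).deriv
  rw [LSeries_sub (ArithmeticFunction.LSeriesSummable_vonMangoldt hs)
      (LSeriesSummable_one_iff.mpr hs),
    ArithmeticFunction.LSeries_vonMangoldt_eq_deriv_riemannZeta_div hs,
    LSeries_one_eq_riemannZeta hs, logDeriv_apply, hd, dslope_of_ne _ hs1, slope_def_field,
    poleFreeZeta_one, poleFreeZeta_eq hs]
  field_simp
  ring

lemma analyticAt_poleFreeZeta {s : ℂ} (hs : 0 < s.re) : AnalyticAt ℂ poleFreeZeta s := by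
  refine DifferentiableOn.analyticAt (s := {z | 0 < z.re})
    (fun z hz => (differentiableAt_poleFreeZeta hz).differentiableWithinAt)
    ((isOpen_lt continuous_const Complex.continuous_re).mem_nhds hs)

lemma differentiableAt_dslope_poleFreeZeta {s : ℂ} (hs : 0 < s.re) :
    DifferentiableAt ℂ (dslope poleFreeZeta 1) s := by
  have hU : IsOpen {z : ℂ | 0 < z.re} := isOpen_lt continuous_const Complex.continuous_re
  refine DifferentiableOn.differentiableAt (s := {z | 0 < z.re}) ?_ (hU.mem_nhds hs)
  rw [Complex.differentiableOn_dslope (hU.mem_nhds (by simp))]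
  exact fun z hz => (differentiableAt_poleFreeZeta hz).differentiableWithinAt

lemma exists_norm_LSeries_weightedDeviation_le :
    ∃ C : ℝ, 0 < C ∧ ∀ s : ℂ, 1 < s.re → s.re ≤ 2 →
      ‖LSeries (fun n => (weightedDeviation n : ℂ)) s‖ ≤ C * (|s.im| + 2) ^ (1 / 2 : ℝ) := by
  have he : (0 : ℝ) < 1 / 200 := by norm_num
  have he' : (1 / 200 : ℝ) ≤ 1 / 4 := by norm_num
  obtain ⟨C₀, hC₀, hZ⟩ := exists_norm_poleFreeZeta_le he he'
  obtain ⟨C₁, hD⟩ := exists_norm_dslope_poleFreeZeta_le he he'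
  obtain ⟨C₂, hC₂, hD'⟩ := exists_norm_iteratedDeriv_le
    (fun s hs => differentiableAt_dslope_poleFreeZeta hs) he he' (by norm_num) hD 4
  have hZ' := fun i => exists_norm_iteratedDeriv_le
    (fun s hs => differentiableAt_poleFreeZeta hs) he he' (by norm_num) hZ i
  choose A hA0 hA using hZ'
  obtain ⟨c, hc, hlow⟩ := exists_le_norm_poleFreeZeta he he'
  obtain ⟨M, hM, hL⟩ := exists_norm_iteratedDeriv_logDeriv_le 4
  set S := 1 + ∑ i ∈ range 6, A i / c with hS
  have hS0 : 0 ≤ ∑ i ∈ range 6, A i / c := sum_nonneg fun i _ => by have := hA0 i; positivity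
  have hS1 : 1 ≤ S := by linarith
  have hAS : ∀ i ≤ 5, A i / c ≤ S := by
    intro i hi
    have := single_le_sum (f := fun i => A i / c) (s := range 6)
      (fun i _ => by have := hA0 i; positivity) (mem_range.mpr (by omega : i < 6))
    linarith
  refine ⟨M * S ^ 5 + C₂, by positivity, fun s h1 h2 => ?_⟩
  have hs0 : 0 < s.re := by linarith
  have hev : LSeries ((fun n => (ArithmeticFunction.vonMangoldt n : ℂ)) - 1) =ᶠ[nhds s]
      -logDeriv poleFreeZeta - dslope poleFreeZeta 1 := by
    filter_upwards [(isOpen_lt continuous_const Complex.continuous_re).mem_nhds h1] with z hz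
    exact LSeries_vonMangoldt_sub_one_eq hz
  have hZan := analyticAt_poleFreeZeta hs0
  have hlog : AnalyticAt ℂ (logDeriv poleFreeZeta) s :=
    hZan.deriv.div hZan (poleFreeZeta_ne_zero h1)
  have hds : AnalyticAt ℂ (dslope poleFreeZeta 1) s := by
    refine DifferentiableOn.analyticAt (s := {z | 0 < z.re})
      (fun z hz => (differentiableAt_dslope_poleFreeZeta hz).differentiableWithinAt)
      ((isOpen_lt continuous_const Complex.continuous_re).mem_nhds hs0)
  have key : LSeries (fun n => (weightedDeviation n : ℂ)) s
      = -iteratedDeriv 4 (logDeriv poleFreeZeta) s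
        - iteratedDeriv 4 (dslope poleFreeZeta 1) s := by
    have := LSeries_iteratedDeriv 4 (abscissaOfAbsConv_vonMangoldt_sub_one_lt h1)
    rw [← ofReal_weightedDeviation, hev.iteratedDeriv_eq,
      iteratedDeriv_sub hlog.neg.contDiffAt hds.contDiffAt, iteratedDeriv_neg] at this
    rw [this]; norm_num
  set W := |s.im| + 2 with hW
  have hW2 : 2 ≤ W := by have := abs_nonneg s.im; linarith
  have hlow' := hlow s h1 h2
  set u := W ^ (1 / 50 : ℝ) with hu
  have hu1 : 1 ≤ u := Real.one_le_rpow (by linarith) (by norm_num)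
  have hv : W ^ (-(4 * (1 / 200)) : ℝ) = u⁻¹ := by
    rw [Real.rpow_neg (by linarith)]; norm_num [hu]
  have hWp : W ^ (1 + 4 * (1 / 200) : ℝ) = W * u := by
    rw [Real.rpow_add (by linarith), Real.rpow_one]; norm_num [hu]
  rw [hv] at hlow'
  have h25 : (u ^ 5) ^ 5 = W ^ (1 / 2 : ℝ) := by
    rw [hu, ← Real.rpow_natCast, ← Real.rpow_natCast, ← Real.rpow_mul (by linarith),
      ← Real.rpow_mul (by linarith)]
    norm_num
  have hratio : ∀ i ≤ 4 + 1, ‖iteratedDeriv i poleFreeZeta s‖ ≤ S * u ^ 5 * ‖poleFreeZeta s‖ := by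
    intro i hi
    have ha := hA i s h1.le h2
    rw [← hW, hWp] at ha
    have hAi := hA0 i
    calc _ ≤ A i * (W * u) := ha
      _ = A i / c * u ^ 5 * (c * W * u⁻¹ ^ 4) := by field_simp
      _ ≤ S * u ^ 5 * ‖poleFreeZeta s‖ := by
          gcongr
          exact hAS i hi
  have b1 := hL poleFreeZeta s (S * u ^ 5) hZan (poleFreeZeta_ne_zero h1)
    (one_le_mul_of_one_le_of_one_le hS1 (one_le_pow₀ hu1)) hratio
  have b2 := hD' s h1.le h2
  rw [key]
  refine (norm_sub_le _ _).trans ?_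
  rw [norm_neg, add_mul]
  refine add_le_add (b1.trans (le_of_eq ?_)) (b2.trans ?_)
  · rw [← h25]; ring
  · gcongr
    · linarith
    · norm_num

open MeasureTheory

/-- The Cesàro weight `(1 - y)₊` on the positive reals. -/
noncomputable def cesaroWeight (y : ℝ) : ℂ :=
  (Set.Ioc (0 : ℝ) 1).indicator (fun _ => (1 : ℂ)) y
    - (Set.Ioc (0 : ℝ) 1).indicator (fun t : ℝ => (t : ℂ) ^ (1 : ℂ)) y

lemma cesaroWeight_of_pos {y : ℝ} (hy : 0 < y) : cesaroWeight y = ((max (1 - y) 0 : ℝ) : ℂ) := by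
  rcases le_or_gt y 1 with h | h
  · have hm : y ∈ Set.Ioc (0 : ℝ) 1 := ⟨hy, h⟩
    rw [cesaroWeight, Set.indicator_of_mem hm, Set.indicator_of_mem hm,
      max_eq_left (by linarith)]
    simp
  · have hm : y ∉ Set.Ioc (0 : ℝ) 1 := fun hm => absurd hm.2 (not_le.mpr h)
    rw [cesaroWeight, Set.indicator_of_notMem hm, Set.indicator_of_notMem hm,
      max_eq_right (by linarith)]
    simp

lemma hasMellin_cesaroWeight {s : ℂ} (hs : 0 < s.re) :
    HasMellin cesaroWeight s (1 / s - 1 / (s + 1)) := by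
  have h1 := hasMellin_one_Ioc hs
  have h2 := hasMellin_cpow_Ioc 1 (s := s) (by simp; linarith)
  have := hasMellin_sub h1.1 h2.1
  rwa [h1.2, h2.2] at this

lemma norm_mellin_cesaroWeight_le {σ : ℝ} (hσ : 1 ≤ σ) (t : ℝ) :
    ‖mellin cesaroWeight (σ + t * Complex.I)‖ ≤ (1 + t ^ 2)⁻¹ := by
  have hre : (σ + t * Complex.I : ℂ).re = σ := by simp
  rw [(hasMellin_cesaroWeight (by rw [hre]; linarith)).2]
  have h0 : (σ + t * Complex.I : ℂ) ≠ 0 := fun h => by rw [h] at hre; simp at hre; linarith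
  have h1 : (σ + t * Complex.I + 1 : ℂ) ≠ 0 := fun h => by
    have := congrArg Complex.re h
    simp at this; linarith
  have e : (1 / (σ + t * Complex.I) - 1 / (σ + t * Complex.I + 1) : ℂ)
      = ((σ + t * Complex.I) * (σ + t * Complex.I + 1))⁻¹ := by
    field_simp; ring
  rw [e, norm_inv, norm_mul]
  have b1 : √(1 + t ^ 2) ≤ ‖(σ + t * Complex.I : ℂ)‖ := by
    rw [Complex.norm_def]
    apply Real.sqrt_le_sqrt
    simp [Complex.normSq_apply]; nlinarith
  have b2 : √(1 + t ^ 2) ≤ ‖(σ + t * Complex.I + 1 : ℂ)‖ := by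
    rw [Complex.norm_def]
    apply Real.sqrt_le_sqrt
    simp [Complex.normSq_apply]; nlinarith
  refine inv_anti₀ (by positivity) ?_
  calc 1 + t ^ 2 = √(1 + t ^ 2) * √(1 + t ^ 2) := (Real.mul_self_sqrt (by positivity)).symm
    _ ≤ _ := by gcongr

lemma continuous_mellin_cesaroWeight {σ : ℝ} (hσ : 1 ≤ σ) :
    Continuous fun t : ℝ => mellin cesaroWeight (σ + t * Complex.I) := by
  have hre (t : ℝ) : (σ + t * Complex.I : ℂ).re = σ := by simp
  have e : (fun t : ℝ => mellin cesaroWeight (σ + t * Complex.I))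
      = fun t : ℝ => (1 / (σ + t * Complex.I) - 1 / (σ + t * Complex.I + 1) : ℂ) := by
    ext t
    exact (hasMellin_cesaroWeight (by rw [hre]; linarith)).2
  rw [e]
  refine Continuous.sub ?_ ?_
  · refine continuous_const.div (by fun_prop) fun t h => ?_
    have := congrArg Complex.re h
    simp at this; linarith
  · refine continuous_const.div (by fun_prop) fun t h => ?_
    have := congrArg Complex.re h
    simp at this; linarith

lemma mellinInv_cesaroWeight {σ : ℝ} (hσ : 1 ≤ σ) {y : ℝ} (hy : 0 < y) :
    ∫ t : ℝ, (y : ℂ) ^ (-(σ + t * Complex.I)) * mellin cesaroWeight (σ + t * Complex.I)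
      = (2 * Real.pi) * cesaroWeight y := by
  have hc : ContinuousAt cesaroWeight y := by
    have : ContinuousAt (fun y : ℝ => ((max (1 - y) 0 : ℝ) : ℂ)) y := by fun_prop
    refine this.congr ?_
    filter_upwards [lt_mem_nhds hy] with z hz
    exact (cesaroWeight_of_pos hz).symm
  have hv : Complex.VerticalIntegrable (mellin cesaroWeight) σ :=
    integrable_inv_one_add_sq.mono' (continuous_mellin_cesaroWeight hσ).aestronglyMeasurable
      (Eventually.of_forall (norm_mellin_cesaroWeight_le hσ))
  have := mellinInv_mellin_eq σ cesaroWeight hy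
    (hasMellin_cesaroWeight (by simp; linarith)).1 hv hc
  rw [mellinInv] at this
  rw [← this, Complex.real_smul]
  have hpi : (Real.pi : ℂ) ≠ 0 := by exact_mod_cast Real.pi_ne_zero
  push_cast
  simp only [smul_eq_mul]
  generalize (∫ t : ℝ, (y : ℂ) ^ (-(σ + t * Complex.I)) * mellin cesaroWeight (σ + t * Complex.I))
    = A
  field_simp

lemma rpow_half_height_le (t : ℝ) :
    (|t| + 2) ^ (1 / 2 : ℝ) * (1 + t ^ 2)⁻¹ ≤ 2 * (1 + ‖t‖ ^ 2) ^ (-(3 / 2) / 2 : ℝ) := by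
  have hp : 0 < 1 + t ^ 2 := by positivity
  have h1 : (|t| + 2) ^ (1 / 2 : ℝ) ≤ 2 * (1 + t ^ 2) ^ (1 / 4 : ℝ) := by
    have h2 : (|t| + 2) ^ 2 ≤ 16 * (1 + t ^ 2) := by
      have := sq_abs t
      nlinarith [sq_nonneg (|t| - 2)]
    calc (|t| + 2) ^ (1 / 2 : ℝ) = ((|t| + 2) ^ 2) ^ (1 / 4 : ℝ) := by
          rw [← Real.rpow_natCast, ← Real.rpow_mul (by positivity)]; norm_num
      _ ≤ (16 * (1 + t ^ 2)) ^ (1 / 4 : ℝ) := by gcongr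
      _ = 2 * (1 + t ^ 2) ^ (1 / 4 : ℝ) := by
          rw [Real.mul_rpow (by norm_num) hp.le, show (16 : ℝ) = 2 ^ (4 : ℝ) by norm_num,
            ← Real.rpow_mul (by norm_num)]
          norm_num
  rw [Real.norm_eq_abs, sq_abs, ← Real.rpow_neg_one (1 + t ^ 2)]
  calc _ ≤ 2 * (1 + t ^ 2) ^ (1 / 4 : ℝ) * (1 + t ^ 2) ^ (-1 : ℝ) := by gcongr
    _ = _ := by rw [mul_assoc, ← Real.rpow_add hp]; norm_num

lemma hasSum_weightedDeviation_cesaro {σ : ℝ} (hσ : 1 < σ) {x : ℝ} (hx : 0 < x) :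
    HasSum (fun n : ℕ => (2 * Real.pi) * ((weightedDeviation n : ℂ) * cesaroWeight (n / x)))
      (∫ t : ℝ, LSeries (fun n => (weightedDeviation n : ℂ)) (σ + t * Complex.I)
        * ((x : ℂ) ^ (σ + t * Complex.I : ℂ) * mellin cesaroWeight (σ + t * Complex.I))) := by
  set a : ℕ → ℂ := fun n => (weightedDeviation n : ℂ) with ha
  set m : ℝ → ℂ := fun t => mellin cesaroWeight (σ + t * Complex.I) with hm
  set F : ℕ → ℝ → ℂ := fun n t => LSeries.term a (σ + t * Complex.I) n
    * ((x : ℂ) ^ (σ + t * Complex.I : ℂ) * m t) with hF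
  have hxc : (x : ℂ) ≠ 0 := by exact_mod_cast hx.ne'
  have hcont (n : ℕ) : Continuous (F n) := by
    refine Continuous.mul ?_ (Continuous.mul ?_ (continuous_mellin_cesaroWeight hσ.le))
    · rcases eq_or_ne n 0 with rfl | hn
      · simp only [LSeries.term_zero]; exact continuous_const
      · simp only [LSeries.term_of_ne_zero hn]
        have hnc : (n : ℂ) ≠ 0 := by exact_mod_cast hn
        refine continuous_const.div ?_ fun t => by simp [Complex.cpow_eq_zero_iff, hnc]
        exact Continuous.const_cpow (by fun_prop) (Or.inl hnc)
    · exact Continuous.const_cpow (by fun_prop) (Or.inl hxc)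
  have hterm (n : ℕ) (t : ℝ) :
      ‖LSeries.term a (σ + t * Complex.I) n‖ = ‖LSeries.term a σ n‖ := by
    rw [LSeries.norm_term_eq, LSeries.norm_term_eq]; simp
  have hbound (n : ℕ) (t : ℝ) : ‖F n t‖ ≤ ‖LSeries.term a σ n‖ * x ^ σ * (1 + t ^ 2)⁻¹ := by
    rw [hF]
    simp only [norm_mul]
    rw [hterm, Complex.norm_cpow_eq_rpow_re_of_pos hx, ← mul_assoc]
    have e : (σ + t * Complex.I : ℂ).re = σ := by simp
    rw [e]
    gcongr
    exact norm_mellin_cesaroWeight_le hσ.le t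
  have hF_int (n : ℕ) : Integrable (F n) :=
    (integrable_inv_one_add_sq.const_mul _).mono' (hcont n).aestronglyMeasurable
      (Eventually.of_forall (hbound n))
  have hsum : Summable fun n => ∫ t, ‖F n t‖ := by
    have hs := (LSeriesSummable_weightedDeviation (s := σ) (by simpa)).norm
    refine Summable.of_nonneg_of_le (fun n => integral_nonneg fun t => norm_nonneg _)
      (fun n => integral_mono (hF_int n).norm (integrable_inv_one_add_sq.const_mul _) (hbound n)) ?_
    simp_rw [integral_const_mul]
    exact (hs.mul_right _).mul_right _
  have key := hasSum_integral_of_summable_integral_norm hF_int hsum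
  have e1 : ∀ n, ∫ t, F n t = (2 * Real.pi) * (a n * cesaroWeight (n / x)) := by
    intro n
    rcases eq_or_ne n 0 with rfl | hn
    · simp [hF, ha, weightedDeviation]
    · have hn0 : (0 : ℝ) < n := by positivity
      have hnc : (n : ℂ) ≠ 0 := by exact_mod_cast hn
      have e2 : ∀ t, F n t = a n * (((n / x : ℝ) : ℂ) ^ (-(σ + t * Complex.I)) * m t) := by
        intro t
        simp only [hF]
        rw [LSeries.term_of_ne_zero hn, Complex.cpow_neg, Complex.ofReal_div,
          Complex.div_cpow_ofReal_nonneg hn0.le hx.le]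
        · simp only [Complex.ofReal_natCast]
          rw [inv_div]; ring
      simp_rw [e2]
      rw [integral_const_mul, mellinInv_cesaroWeight hσ.le (by positivity)]
      ring
  simp_rw [e1] at key
  have e3 : ∀ t : ℝ, ∑' i, F i t = LSeries a (σ + t * Complex.I)
      * ((x : ℂ) ^ (σ + t * Complex.I : ℂ) * m t) := fun t => by
    simp only [hF]; rw [tsum_mul_right]; rfl
  simp_rw [e3] at key
  exact key

lemma exists_abs_sum_cesaro_le : ∃ C : ℝ, 0 < C ∧ ∀ N : ℕ, 3 ≤ N →
    |∑ n ∈ range N, weightedDeviation n * (1 - n / N)| ≤ C * N := by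
  obtain ⟨C, hC, hL⟩ := exists_norm_LSeries_weightedDeviation_le
  set J := ∫ t : ℝ, 2 * (1 + ‖t‖ ^ 2) ^ (-(3 / 2) / 2 : ℝ) with hJ
  have hJi : Integrable fun t : ℝ => 2 * (1 + ‖t‖ ^ 2) ^ (-(3 / 2) / 2 : ℝ) :=
    (integrable_rpow_neg_one_add_norm_sq (by simp; norm_num)).const_mul 2
  have hJ0 : 0 ≤ J := integral_nonneg fun t => by positivity
  refine ⟨C * Real.exp 1 * (J + 1), by positivity, fun N hN => ?_⟩
  have hN0 : (0 : ℝ) < N := by positivity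
  have hlog : 1 ≤ Real.log N := by
    rw [Real.le_log_iff_exp_le hN0]
    have : (3 : ℝ) ≤ N := by exact_mod_cast hN
    linarith [Real.exp_one_lt_d9]
  set σ := 1 + 1 / Real.log N with hσd
  have hσ : 1 < σ := by simp [hσd]; linarith
  have hσ2 : σ ≤ 2 := by
    have : 1 / Real.log N ≤ 1 := by rw [div_le_one (by linarith)]; exact hlog
    linarith
  have hNσ : (N : ℝ) ^ σ = N * Real.exp 1 := by
    rw [hσd, Real.rpow_add hN0, Real.rpow_one, Real.rpow_def_of_pos hN0]
    congr 2
    field_simp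
  have hs := hasSum_weightedDeviation_cesaro hσ hN0
  have hfin : HasSum (fun n : ℕ => (2 * Real.pi) *
      ((weightedDeviation n : ℂ) * cesaroWeight (n / N)))
      (∑ n ∈ range N, (2 * Real.pi) * ((weightedDeviation n : ℂ) * cesaroWeight (n / N))) := by
    refine hasSum_sum_of_ne_finset_zero fun n hn => ?_
    have hn' : N ≤ n := by simpa using hn
    have hn1 : (1 : ℝ) ≤ n / N := by rw [one_le_div hN0]; exact_mod_cast hn'
    rw [cesaroWeight_of_pos (by linarith), max_eq_right (by linarith)]
    simp
  have heq := hfin.unique hs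
  have hsumeq : (∑ n ∈ range N, (2 * Real.pi) * ((weightedDeviation n : ℂ) * cesaroWeight (n / N)))
      = ((2 * Real.pi * ∑ n ∈ range N, weightedDeviation n * (1 - n / N) : ℝ) : ℂ) := by
    rw [mul_sum]
    push_cast
    refine sum_congr rfl fun n hn => ?_
    rcases eq_or_ne n 0 with rfl | hn0
    · simp [weightedDeviation]
    · have : (n : ℝ) / N ≤ 1 := by
        rw [div_le_one hN0]; exact_mod_cast (mem_range.mp hn).le
      rw [cesaroWeight_of_pos (by positivity), max_eq_left (by linarith)]
      push_cast; ring
  rw [hsumeq] at heq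
  have hnorm := congrArg norm heq
  rw [Complex.norm_real, Real.norm_eq_abs, abs_mul, abs_of_pos (by positivity)] at hnorm
  have hb : ‖∫ t : ℝ, LSeries (fun n => (weightedDeviation n : ℂ)) (σ + t * Complex.I)
        * (((N : ℝ) : ℂ) ^ (σ + t * Complex.I : ℂ) * mellin cesaroWeight (σ + t * Complex.I))‖
      ≤ C * (N * Real.exp 1) * J := by
    rw [hJ, ← integral_const_mul]
    refine norm_integral_le_of_norm_le (hJi.const_mul _) (Eventually.of_forall fun t => ?_)
    have e : (σ + t * Complex.I : ℂ).re = σ := by simp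
    have e' : (σ + t * Complex.I : ℂ).im = t := by simp
    have h1 := hL (σ + t * Complex.I) (by rwa [e]) (by rwa [e])
    rw [e'] at h1
    rw [norm_mul, norm_mul, Complex.norm_cpow_eq_rpow_re_of_pos hN0, e, hNσ]
    calc _ ≤ C * (|t| + 2) ^ (1 / 2 : ℝ) * (N * Real.exp 1 * (1 + t ^ 2)⁻¹) := by
          gcongr
          exact norm_mellin_cesaroWeight_le hσ.le t
      _ = C * (N * Real.exp 1) * ((|t| + 2) ^ (1 / 2 : ℝ) * (1 + t ^ 2)⁻¹) := by ring
      _ ≤ _ := mul_le_mul_of_nonneg_left (rpow_half_height_le t) (by positivity)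
  rw [← hnorm] at hb
  have hpi : 1 ≤ 2 * Real.pi := by linarith [Real.pi_gt_three]
  calc _ = 1 * |∑ n ∈ range N, weightedDeviation n * (1 - n / N)| := (one_mul _).symm
    _ ≤ 2 * Real.pi * |∑ n ∈ range N, weightedDeviation n * (1 - n / N)| := by gcongr
    _ ≤ _ := hb
    _ ≤ C * (N * Real.exp 1) * (J + 1) := by gcongr; linarith
    _ = _ := by ring

lemma one_add_log_nat_pos (n : ℕ) : 1 ≤ 1 + Real.log n := by
  linarith [Real.log_natCast_nonneg n]

lemma one_add_log_sq_le {N : ℕ} (hN : 1 ≤ N) : (1 + Real.log N) ^ 2 ≤ 4 * N := by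
  have hN' : (1 : ℝ) ≤ N := by exact_mod_cast hN
  have h1 := Real.log_le_sub_one_of_pos (Real.sqrt_pos.mpr (by linarith : (0 : ℝ) < N))
  rw [Real.log_sqrt (by linarith)] at h1
  have h2 := Real.sq_sqrt (by linarith : (0 : ℝ) ≤ N)
  have h3 : 1 + Real.log N ≤ 2 * √N := by linarith
  nlinarith [one_add_log_nat_pos N, Real.sqrt_nonneg (N : ℝ)]

lemma neg_le_weightedDeviation {n : ℕ} {L : ℝ} (h : Real.log n ≤ L) :
    -L ^ 4 ≤ weightedDeviation n := by
  have h0 := Real.log_natCast_nonneg n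
  have h1 : Real.log n ^ 4 ≤ L ^ 4 := by gcongr
  have h2 := mul_nonneg (ArithmeticFunction.vonMangoldt_nonneg (n := n)) (pow_nonneg h0 4)
  rw [weightedDeviation]
  linarith

/-- A sum of terms bounded below is controlled by its Cesàro means. -/
lemma abs_sum_range_le_of_cesaro {a : ℕ → ℝ} {T L : ℝ} {N H : ℕ} (hHN : H ≤ N)
    (ha : ∀ n ≤ 2 * N, -L ≤ a n) (hL : 0 ≤ L)
    (hT : ∀ M ≤ 2 * N, |∑ n ∈ range M, a n * ((M : ℝ) - n)| ≤ T) :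
    H * |∑ n ∈ range N, a n| ≤ 2 * T + H ^ 2 * L := by
  set S : ℕ → ℝ := fun m => ∑ n ∈ range m, a n with hS
  set U : ℕ → ℝ := fun m => ∑ n ∈ range m, a n * ((m : ℝ) - n) with hU
  have hstep (m : ℕ) : U (m + 1) = U m + S (m + 1) := by
    simp only [hU, hS, sum_range_succ]
    rw [show (∑ x ∈ range m, a x * (((m + 1 : ℕ) : ℝ) - x))
      = ∑ x ∈ range m, a x * ((m : ℝ) - x) + ∑ x ∈ range m, a x by
        rw [← sum_add_distrib]; refine sum_congr rfl fun _ _ => ?_; push_cast; ring]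
    push_cast; ring
  have hdiff (m h : ℕ) : U (m + h) = U m + ∑ i ∈ range h, S (m + i + 1) := by
    induction h with
    | zero => simp
    | succ h ih => rw [← add_assoc, hstep, ih, sum_range_succ]; ring
  have hmono (m h : ℕ) (hm : m + h ≤ 2 * N) : S m - h * L ≤ S (m + h) := by
    induction h with
    | zero => simp
    | succ h ih =>
      have h1 := ih (by omega)
      have h2 := ha (m + h) (by omega)
      have h3 : S (m + (h + 1)) = S (m + h) + a (m + h) := by
        simp only [hS, ← add_assoc, sum_range_succ]
      rw [h3]; push_cast; linarith
  have hup : U N + H * (S N - H * L) ≤ U (N + H) := by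
    rw [hdiff]
    have : ∑ i ∈ range H, (S N - H * L) ≤ ∑ i ∈ range H, S (N + i + 1) := by
      refine sum_le_sum fun i hi => ?_
      have hi' : i + 1 ≤ H := mem_range.mp hi
      have := hmono N (i + 1) (by omega)
      have h2 : ((i + 1 : ℕ) : ℝ) * L ≤ H * L := by gcongr
      rw [← add_assoc] at this
      linarith
    rw [sum_const, card_range, nsmul_eq_mul] at this
    linarith
  have hlo : U N ≤ U (N - H) + H * (S N + H * L) := by
    have e : N - H + H = N := Nat.sub_add_cancel hHN
    conv_lhs => rw [← e, hdiff]
    have : ∑ i ∈ range H, S (N - H + i + 1) ≤ ∑ i ∈ range H, (S N + H * L) := by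
      refine sum_le_sum fun i hi => ?_
      have hi' : i + 1 ≤ H := mem_range.mp hi
      have := hmono (N - H + i + 1) (H - (i + 1)) (by omega)
      rw [show N - H + i + 1 + (H - (i + 1)) = N by omega] at this
      have h2 : ((H - (i + 1) : ℕ) : ℝ) * L ≤ H * L := by gcongr; omega
      linarith
    rw [sum_const, card_range, nsmul_eq_mul] at this
    linarith
  have t1 := abs_le.mp (hT N (by omega))
  have t2 := abs_le.mp (hT (N + H) (by omega))
  have t3 := abs_le.mp (hT (N - H) (by omega))
  change (H : ℝ) * |S N| ≤ _
  rw [← abs_of_nonneg (Nat.cast_nonneg H : (0 : ℝ) ≤ H), ← abs_mul, abs_le,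
    abs_of_nonneg (Nat.cast_nonneg H : (0 : ℝ) ≤ H)]
  constructor
  · nlinarith [t1.1, t3.2]
  · nlinarith [t1.1, t2.2]

lemma exists_abs_sum_range_weightedDeviation_le : ∃ C : ℝ, 0 < C ∧ ∀ N : ℕ, 1 ≤ N →
    |∑ n ∈ range N, weightedDeviation n| ≤ C * N * (1 + Real.log N) ^ 2 := by
  obtain ⟨C, hC, h⟩ := exists_abs_sum_cesaro_le
  refine ⟨8 * C + 5, by positivity, fun N hN => ?_⟩
  have hN0 : (0 : ℝ) < N := by exact_mod_cast hN
  have hT : ∀ M ≤ 2 * N, |∑ n ∈ range M, weightedDeviation n * ((M : ℝ) - n)| ≤ C * (2 * N) ^ 2 := by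
    intro M hM
    have hM2 : (M : ℝ) ≤ 2 * N := by exact_mod_cast hM
    rcases lt_or_ge M 3 with hM3 | hM3
    · have : ∑ n ∈ range M, weightedDeviation n * ((M : ℝ) - n) = 0 := by
        refine sum_eq_zero fun n hn => ?_
        have h01 : n = 0 ∨ n = 1 := by have := mem_range.mp hn; omega
        rcases h01 with rfl | rfl <;> simp [weightedDeviation]
      rw [this, abs_zero]; positivity
    · have hM0 : (0 : ℝ) < M := by positivity
      have e : ∑ n ∈ range M, weightedDeviation n * ((M : ℝ) - n)
          = M * ∑ n ∈ range M, weightedDeviation n * (1 - n / M) := by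
        rw [mul_sum]; refine sum_congr rfl fun n _ => ?_; field_simp
      rw [e, abs_mul, abs_of_pos hM0]
      calc _ ≤ (M : ℝ) * (C * M) := by gcongr; exact h M hM3
        _ = C * M ^ 2 := by ring
        _ ≤ _ := by gcongr
  set l := 1 + Real.log N with hl
  have hl1 : 1 ≤ l := one_add_log_nat_pos N
  have hl4 : l ^ 2 ≤ 4 * N := one_add_log_sq_le hN
  set H := ⌈(N : ℝ) / l ^ 2⌉₊ with hH
  have hH1 : N / l ^ 2 ≤ H := Nat.le_ceil _
  have hH2 : (H : ℝ) ≤ 5 * (N / l ^ 2) := by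
    have h1 := (Nat.ceil_lt_add_one (by positivity : 0 ≤ (N : ℝ) / l ^ 2)).le
    have h2 : 1 ≤ 4 * ((N : ℝ) / l ^ 2) := by
      rw [← mul_div_assoc, one_le_div (by positivity)]; exact hl4
    linarith
  have hH0 : (0 : ℝ) < H := lt_of_lt_of_le (by positivity) hH1
  have hHN : H ≤ N := by
    refine Nat.ceil_le.mpr ?_
    exact div_le_self hN0.le (one_le_pow₀ hl1)
  have ha : ∀ n ≤ 2 * N, -l ^ 4 ≤ weightedDeviation n := by
    intro n hn
    refine neg_le_weightedDeviation ?_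
    rcases Nat.eq_zero_or_pos n with rfl | hn0
    · simp; linarith
    · have h1 : Real.log n ≤ Real.log (2 * N) :=
        Real.log_le_log (by exact_mod_cast hn0) (by exact_mod_cast hn)
      rw [Real.log_mul (by norm_num) hN0.ne'] at h1
      linarith [Real.log_two_lt_d9]
  have key := abs_sum_range_le_of_cesaro hHN ha (by positivity) hT
  set A := |∑ n ∈ range N, weightedDeviation n|
  have e1 : A ≤ 2 * (C * (2 * N) ^ 2) / H + H * l ^ 4 := by
    rw [div_add' _ _ _ hH0.ne', le_div_iff₀ hH0]
    linarith
  calc A ≤ _ := e1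
    _ ≤ 2 * (C * (2 * N) ^ 2) / (N / l ^ 2) + 5 * (N / l ^ 2) * l ^ 4 := by gcongr
    _ = _ := by field_simp; ring

lemma sum_range_mul_eq_by_parts (a g : ℕ → ℝ) (N : ℕ) :
    ∑ n ∈ range N, a n * g n = (∑ n ∈ range N, a n) * g N
      + ∑ n ∈ range N, (∑ m ∈ range (n + 1), a m) * (g n - g (n + 1)) := by
  induction N with
  | zero => simp
  | succ N ih =>
    rw [sum_range_succ, ih, sum_range_succ (fun n => (∑ m ∈ range (n + 1), a m) * (g n - g (n + 1))),
      sum_range_succ a]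
    ring

lemma one_add_log_le_of_le {m n : ℕ} (h : m ≤ n) : 1 + Real.log m ≤ 1 + Real.log n := by
  rcases Nat.eq_zero_or_pos m with rfl | hm
  · simpa using Real.log_natCast_nonneg n
  · gcongr

/-- The decreasing weight `1 / (log n)^4`, frozen below `n = 2`. -/
noncomputable def logWeight (n : ℕ) : ℝ := 1 / max (Real.log n) (Real.log 2) ^ 4

lemma antitone_logWeight : Antitone logWeight := by
  intro m n h
  have h2 : 0 < Real.log 2 := Real.log_pos (by norm_num)
  have := one_add_log_le_of_le h
  have h3 : 0 < max (Real.log m) (Real.log 2) := lt_max_of_lt_right h2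
  rw [logWeight, logWeight]
  refine one_div_le_one_div_of_le (by positivity) (pow_le_pow_left₀ h3.le ?_ 4)
  exact max_le_max_right _ (by linarith)

lemma logWeight_nonneg (n : ℕ) : 0 ≤ logWeight n := by
  rw [logWeight]; positivity

lemma logWeight_le (n : ℕ) : logWeight n ≤ 81 / (1 + Real.log n) ^ 4 := by
  have h2 : 0.5 < Real.log 2 := by linarith [Real.log_two_gt_d9]
  have h3 : 0 < max (Real.log n) (Real.log 2) := lt_max_of_lt_right (by linarith)
  have h4 : 1 + Real.log n ≤ 3 * max (Real.log n) (Real.log 2) := by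
    linarith [le_max_left (Real.log n) (Real.log 2), le_max_right (Real.log n) (Real.log 2)]
  have h5 := one_add_log_nat_pos n
  rw [logWeight, div_le_div_iff₀ (by positivity) (by positivity)]
  calc _ = (1 + Real.log n) ^ 4 := by ring
    _ ≤ (3 * max (Real.log n) (Real.log 2)) ^ 4 := by gcongr
    _ = _ := by ring

lemma one_add_log_pow_four_le {N : ℕ} (hN : 1 ≤ N) : (1 + Real.log N) ^ 4 ≤ 4096 * √N := by
  have hN' : (1 : ℝ) ≤ N := by exact_mod_cast hN
  have h0 : (0 : ℝ) < (N : ℝ) ^ (1 / 8 : ℝ) := by positivity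
  have h1 := Real.log_le_sub_one_of_pos h0
  rw [Real.log_rpow (by linarith)] at h1
  have h3 : 1 + Real.log N ≤ 8 * (N : ℝ) ^ (1 / 8 : ℝ) := by linarith
  have h4 := one_add_log_nat_pos N
  calc (1 + Real.log N) ^ 4 ≤ (8 * (N : ℝ) ^ (1 / 8 : ℝ)) ^ 4 := by gcongr
    _ = 4096 * ((N : ℝ) ^ (1 / 8 : ℝ)) ^ (4 : ℕ) := by ring
    _ = _ := by
      rw [← Real.rpow_natCast, ← Real.rpow_mul (by linarith), Real.sqrt_eq_rpow]; norm_num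

lemma sum_logWeight_le {N : ℕ} (hN : 1 ≤ N) :
    ∑ n ∈ range N, logWeight n ≤ 81 * 8208 * N / (1 + Real.log N) ^ 4 := by
  have hN0 : (0 : ℝ) < N := by exact_mod_cast hN
  have hl := one_add_log_nat_pos N
  have hterm (n : ℕ) : logWeight n
      ≤ 81 * 16 / (1 + Real.log N) ^ 4 + if n ∈ range (Nat.sqrt N + 1) then 81 else 0 := by
    refine (logWeight_le n).trans ?_
    have hln := one_add_log_nat_pos n
    split_ifs with h
    · have : 81 / (1 + Real.log n) ^ 4 ≤ 81 := div_le_self (by norm_num) (one_le_pow₀ hln)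
      have : 0 ≤ 81 * 16 / (1 + Real.log N) ^ 4 := by positivity
      linarith
    · have hn : Nat.sqrt N < n := by simpa [Nat.lt_succ_iff] using h
      have hn2 : N ≤ n ^ 2 := by rw [pow_two]; exact (Nat.sqrt_lt.mp hn).le
      have h1 := one_add_log_le_of_le hn2
      push_cast at h1
      rw [Real.log_pow] at h1
      push_cast at h1
      have h2 : 1 + Real.log N ≤ 2 * (1 + Real.log n) := by linarith
      rw [add_zero, div_le_div_iff₀ (by positivity) (by positivity)]
      calc _ ≤ 81 * (2 * (1 + Real.log n)) ^ 4 := by gcongr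
        _ = _ := by ring
  have hsq : (Nat.sqrt N : ℝ) ≤ √N := Real.nat_sqrt_le_real_sqrt
  have hsq1 : 1 ≤ √(N : ℝ) := by rw [Real.one_le_sqrt]; exact_mod_cast hN
  have hcard : ∑ n ∈ range N, (if n ∈ range (Nat.sqrt N + 1) then (81 : ℝ) else 0) ≤ 81 * (2 * √N) := by
    rw [← sum_filter, sum_const, nsmul_eq_mul]
    have : #{n ∈ range N | n ∈ range (Nat.sqrt N + 1)} ≤ Nat.sqrt N + 1 := by
      calc _ ≤ #(range (Nat.sqrt N + 1)) := card_le_card fun n hn => (mem_filter.mp hn).2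
        _ = _ := card_range _
    have h' : (#{n ∈ range N | n ∈ range (Nat.sqrt N + 1)} : ℝ) ≤ Nat.sqrt N + 1 := by
      exact_mod_cast this
    linarith
  have h4 : √(N : ℝ) ≤ 4096 * N / (1 + Real.log N) ^ 4 := by
    rw [le_div_iff₀ (by positivity)]
    calc √(N : ℝ) * (1 + Real.log N) ^ 4 ≤ √N * (4096 * √N) := by
          gcongr; exact one_add_log_pow_four_le hN
      _ = 4096 * (√N * √N) := by ring
      _ = _ := by rw [Real.mul_self_sqrt hN0.le]
  calc _ ≤ ∑ n ∈ range N, (81 * 16 / (1 + Real.log N) ^ 4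
        + if n ∈ range (Nat.sqrt N + 1) then (81 : ℝ) else 0) := sum_le_sum fun n _ => hterm n
    _ ≤ N * (81 * 16 / (1 + Real.log N) ^ 4) + 81 * (2 * (4096 * N / (1 + Real.log N) ^ 4)) := by
        rw [sum_add_distrib, sum_const, card_range, nsmul_eq_mul]
        linarith
    _ = _ := by ring

lemma exists_abs_sum_vonMangoldt_sub_one_le : ∃ C : ℝ, 0 < C ∧ ∀ N : ℕ, 1 ≤ N →
    |∑ n ∈ Ioc 0 N, (ArithmeticFunction.vonMangoldt n - 1)| ≤ C * N / (1 + Real.log N) ^ 2 := by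
  obtain ⟨C, hC, hS⟩ := exists_abs_sum_range_weightedDeviation_le
  set D : ℝ := C * 81 + C * (81 * 8208) with hD
  have main : ∀ N : ℕ, 1 ≤ N →
      |∑ n ∈ range N, weightedDeviation n * logWeight n| ≤ D * N / (1 + Real.log N) ^ 2 := by
    intro N hN
    have hl := one_add_log_nat_pos N
    set l := 1 + Real.log N with hld
    rw [sum_range_mul_eq_by_parts]
    have h1 : |(∑ n ∈ range N, weightedDeviation n) * logWeight N| ≤ C * 81 * N / l ^ 2 := by
      rw [abs_mul, abs_of_nonneg (logWeight_nonneg N)]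
      calc _ ≤ C * N * l ^ 2 * (81 / l ^ 4) :=
            mul_le_mul (hS N hN) (logWeight_le N) (logWeight_nonneg N) (by positivity)
        _ = _ := by field_simp
    have h2 : |∑ n ∈ range N, (∑ m ∈ range (n + 1), weightedDeviation m)
        * (logWeight n - logWeight (n + 1))| ≤ C * (81 * 8208) * N / l ^ 2 := by
      have hparts := sum_range_mul_eq_by_parts (fun _ => 1) logWeight N
      simp only [one_mul, sum_const, card_range, nsmul_eq_mul, mul_one] at hparts
      calc _ ≤ ∑ n ∈ range N, C * l ^ 2 * (((n + 1 : ℕ) : ℝ) * (logWeight n - logWeight (n + 1))) := by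
            refine (abs_sum_le_sum_abs _ _).trans (sum_le_sum fun n hn => ?_)
            have hd : 0 ≤ logWeight n - logWeight (n + 1) :=
              sub_nonneg.mpr (antitone_logWeight n.le_succ)
            rw [abs_mul, abs_of_nonneg hd, ← mul_assoc]
            gcongr
            refine (hS (n + 1) (by omega)).trans ?_
            have h3 := one_add_log_le_of_le (show n + 1 ≤ N from mem_range.mp hn)
            have h4 := one_add_log_nat_pos (n + 1)
            calc _ ≤ C * ((n + 1 : ℕ) : ℝ) * l ^ 2 := by gcongr
              _ = _ := by ring
        _ = C * l ^ 2 * ∑ n ∈ range N, (((n + 1 : ℕ) : ℝ) * (logWeight n - logWeight (n + 1))) := by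
            rw [mul_sum]
        _ ≤ C * l ^ 2 * (81 * 8208 * N / l ^ 4) := by
            gcongr
            have := sum_logWeight_le hN
            have h0 := mul_nonneg (Nat.cast_nonneg N : (0 : ℝ) ≤ N) (logWeight_nonneg N)
            linarith
        _ = _ := by field_simp
    calc _ ≤ _ := abs_add_le _ _
      _ ≤ C * 81 * N / l ^ 2 + C * (81 * 8208) * N / l ^ 2 := add_le_add h1 h2
      _ = _ := by rw [hD]; ring
  refine ⟨2 * D + 4, by positivity, fun N hN => ?_⟩
  have hl := one_add_log_nat_pos N
  have e : ∑ n ∈ Ioc 0 N, (ArithmeticFunction.vonMangoldt n - 1)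
      = ∑ n ∈ range (N + 1), weightedDeviation n * logWeight n - 1 := by
    induction N, hN using Nat.le_induction with
    | base => simp [sum_range_succ, weightedDeviation]
    | succ N hN ih =>
      rw [sum_range_succ, sum_Ioc_succ_top (Nat.zero_le N), ih (one_add_log_nat_pos N)]
      have h2 : Real.log 2 ≤ Real.log ((N + 1 : ℕ) : ℝ) :=
        Real.log_le_log (by norm_num) (by exact_mod_cast (by omega : 2 ≤ N + 1))
      have h0 : 0 < Real.log 2 := Real.log_pos (by norm_num)
      have h3 : Real.log ((N + 1 : ℕ) : ℝ) ≠ 0 := by linarith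
      rw [weightedDeviation, logWeight, max_eq_left h2]
      field_simp
      ring
  rw [e]
  have h1 := main (N + 1) (by omega)
  have h2 := one_add_log_le_of_le (Nat.le_succ N)
  have h3 : D * ((N + 1 : ℕ) : ℝ) / (1 + Real.log ((N + 1 : ℕ) : ℝ)) ^ 2
      ≤ D * (2 * N) / (1 + Real.log N) ^ 2 := by
    have : ((N + 1 : ℕ) : ℝ) ≤ 2 * N := by
      have : N + 1 ≤ 2 * N := by omega
      exact_mod_cast this
    gcongr
  have h4 : 1 ≤ 4 * N / (1 + Real.log N) ^ 2 := by
    rw [one_le_div (by positivity)]; exact one_add_log_sq_le hN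
  calc _ ≤ _ := abs_sub _ _
    _ ≤ D * (2 * N) / (1 + Real.log N) ^ 2 + 4 * N / (1 + Real.log N) ^ 2 := by
        rw [abs_one]; linarith
    _ = _ := by ring

open scoped ArithmeticFunction.vonMangoldt ArithmeticFunction.Moebius ArithmeticFunction.zeta

/-- `log ^ k` as an arithmetic function. -/
noncomputable def logPow (k : ℕ) : ArithmeticFunction ℝ :=
  ⟨fun n => if n = 0 then 0 else Real.log n ^ k, by simp⟩

lemma logPow_apply {k n : ℕ} (hn : n ≠ 0) : logPow k n = Real.log n ^ k := by
  simp [logPow, hn]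

lemma logPow_zero : logPow 0 = (ζ : ArithmeticFunction ℝ) := by
  ext n
  rcases eq_or_ne n 0 with rfl | hn
  · simp
  · simp [logPow_apply hn, hn]

lemma logPow_succ (k : ℕ) : logPow (k + 1) = ArithmeticFunction.log.pmul (logPow k) := by
  ext n
  rcases eq_or_ne n 0 with rfl | hn
  · simp
  · simp [logPow_apply hn, pow_succ']

lemma log_pmul_mul (f g : ArithmeticFunction ℝ) :
    ArithmeticFunction.log.pmul (f * g)
      = ArithmeticFunction.log.pmul f * g + f * ArithmeticFunction.log.pmul g := by
  ext n
  simp only [ArithmeticFunction.pmul_apply, ArithmeticFunction.mul_apply,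
    ArithmeticFunction.add_apply, ArithmeticFunction.log_apply, mul_sum, ← sum_add_distrib]
  refine sum_congr rfl fun p hp => ?_
  obtain ⟨hp, hn⟩ := Nat.mem_divisorsAntidiagonal.mp hp
  have h1 : (p.1 : ℝ) ≠ 0 := by rintro h; simp_all
  have h2 : (p.2 : ℝ) ≠ 0 := by rintro h; simp_all
  rw [← hp, Nat.cast_mul, Real.log_mul h1 h2]
  ring

lemma log_pmul_zeta : ArithmeticFunction.log.pmul (ζ : ArithmeticFunction ℝ) = Λ * ζ := by
  rw [ArithmeticFunction.pmul_zeta, ArithmeticFunction.vonMangoldt_mul_zeta]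

lemma log_pmul_moebius :
    ArithmeticFunction.log.pmul (μ : ArithmeticFunction ℝ) = -(Λ * μ) := by
  have h := log_pmul_mul (μ : ArithmeticFunction ℝ) ζ
  have h1 : ArithmeticFunction.log.pmul (1 : ArithmeticFunction ℝ) = 0 := by
    ext n
    rcases eq_or_ne n 1 with rfl | hn
    · simp
    · simp [ArithmeticFunction.one_apply_ne hn]
  have hμζ : (μ : ArithmeticFunction ℝ) * ζ = 1 := ArithmeticFunction.coe_moebius_mul_coe_zeta
  rw [hμζ, h1, log_pmul_zeta] at h
  set D := ArithmeticFunction.log.pmul (μ : ArithmeticFunction ℝ)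
  linear_combination (-(μ : ArithmeticFunction ℝ)) * h - (D + Λ * μ) * hμζ

/-- `Λ_k` as an arithmetic function. -/
noncomputable def genVonMangoldt (k : ℕ) : ArithmeticFunction ℝ :=
  (μ : ArithmeticFunction ℝ) * logPow k

lemma genVonMangoldt_apply (k n : ℕ) : genVonMangoldt k n = vonMangoldtK k n := by
  rw [genVonMangoldt, ArithmeticFunction.mul_apply, vonMangoldtK,
    Nat.sum_divisorsAntidiagonal fun i j => (μ : ArithmeticFunction ℝ) i * logPow k j]
  refine sum_congr rfl fun d hd => ?_
  obtain ⟨hd, hn⟩ := Nat.mem_divisors.mp hd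
  have hd0 : (d : ℝ) ≠ 0 := by
    rw [Nat.cast_ne_zero]; rintro rfl; exact hn (by simpa using hd)
  rw [ArithmeticFunction.intCoe_apply,
    logPow_apply (Nat.div_pos (Nat.le_of_dvd (Nat.pos_of_ne_zero hn) hd)
      (Nat.pos_of_dvd_of_pos hd (Nat.pos_of_ne_zero hn))).ne', Nat.cast_div hd hd0]

lemma genVonMangoldt_succ (k : ℕ) : genVonMangoldt (k + 1)
    = ArithmeticFunction.log.pmul (genVonMangoldt k) + Λ * genVonMangoldt k := by
  have h := log_pmul_mul (μ : ArithmeticFunction ℝ) (logPow k)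
  rw [log_pmul_moebius] at h
  simp only [genVonMangoldt, logPow_succ]
  linear_combination -h

lemma zeta_mul_genVonMangoldt (k : ℕ) :
    (ζ : ArithmeticFunction ℝ) * genVonMangoldt k = logPow k := by
  rw [genVonMangoldt, ← mul_assoc, ArithmeticFunction.coe_zeta_mul_coe_moebius, one_mul]

lemma genVonMangoldt_one : genVonMangoldt 1 = Λ := by
  rw [genVonMangoldt, logPow_succ, logPow_zero, ArithmeticFunction.pmul_zeta,
    ArithmeticFunction.moebius_mul_log_eq_vonMangoldt]

lemma genVonMangoldt_nonneg (k n : ℕ) : 0 ≤ genVonMangoldt k n := by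
  induction k generalizing n with
  | zero =>
    rw [genVonMangoldt, logPow_zero, ArithmeticFunction.coe_moebius_mul_coe_zeta,
      ArithmeticFunction.one_apply]
    positivity
  | succ k ih =>
    rw [genVonMangoldt_succ, ArithmeticFunction.add_apply, ArithmeticFunction.pmul_apply,
      ArithmeticFunction.mul_apply, ArithmeticFunction.log_apply]
    exact add_nonneg (mul_nonneg (Real.log_natCast_nonneg n) (ih n))
      (sum_nonneg fun p _ => mul_nonneg ArithmeticFunction.vonMangoldt_nonneg (ih _))

/-- The deviation of `Λ_{j+1}` from its mean value `(j + 1) log ^ j`. -/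
noncomputable def genDeviation (j : ℕ) : ArithmeticFunction ℝ :=
  genVonMangoldt (j + 1) - ((j + 1 : ℕ) : ArithmeticFunction ℝ) * logPow j

lemma natCast_mul_apply (m n : ℕ) (f : ArithmeticFunction ℝ) :
    ((m : ArithmeticFunction ℝ) * f) n = m * f n := by
  rw [← nsmul_eq_mul]
  induction m with
  | zero => simp
  | succ m ih => rw [succ_nsmul, ArithmeticFunction.add_apply, ih]; push_cast; ring

lemma sub_apply (f g : ArithmeticFunction ℝ) (n : ℕ) : (f - g) n = f n - g n := by
  have h := congrArg (fun a : ArithmeticFunction ℝ => a n) (sub_add_cancel f g)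
  simp only [ArithmeticFunction.add_apply] at h
  linarith

lemma genDeviation_apply (j n : ℕ) :
    genDeviation j n = genVonMangoldt (j + 1) n - (j + 1) * logPow j n := by
  rw [genDeviation, sub_apply, natCast_mul_apply]; push_cast; rfl

lemma genDeviation_succ_apply (j n : ℕ) : genDeviation (j + 1) n
    = genDeviation j n * Real.log n + (genVonMangoldt (j + 1) * (Λ - ζ)) n := by
  have h : genVonMangoldt (j + 1) * (Λ - (ζ : ArithmeticFunction ℝ))
      = Λ * genVonMangoldt (j + 1) - logPow (j + 1) := by
    rw [← zeta_mul_genVonMangoldt]; ring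
  rw [h, genDeviation_apply, genDeviation_apply, genVonMangoldt_succ (j + 1), logPow_succ,
    sub_apply]
  simp only [ArithmeticFunction.add_apply, ArithmeticFunction.pmul_apply,
    ArithmeticFunction.log_apply]
  push_cast
  ring

lemma sum_range_succ_eq_sum_Ioc (f : ArithmeticFunction ℝ) (N : ℕ) :
    ∑ n ∈ range (N + 1), f n = ∑ n ∈ Ioc 0 N, f n := by
  induction N with
  | zero => simp
  | succ N ih => rw [sum_range_succ, ih, sum_Ioc_succ_top (Nat.zero_le N)]

/-- Weighting by `log` costs at most a factor `1 + log N` in the summatory function. -/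
lemma abs_sum_mul_log_le {a : ArithmeticFunction ℝ} {C : ℝ} (hC : 0 ≤ C) {j : ℕ}
    (ha : ∀ N : ℕ, 1 ≤ N → |∑ n ∈ Ioc 0 N, a n| ≤ C * N * (1 + Real.log N) ^ j / (1 + Real.log N))
    {N : ℕ} (hN : 1 ≤ N) :
    |∑ n ∈ Ioc 0 N, a n * Real.log n| ≤ 2 * C * N * (1 + Real.log N) ^ j := by
  have hl := one_add_log_nat_pos N
  set l := 1 + Real.log N with hld
  have hlog (n : ℕ) (hn : 1 ≤ n) : Real.log ((n + 1 : ℕ) : ℝ) - Real.log n ≤ 1 / n := by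
    have hn0 : (0 : ℝ) < n := by exact_mod_cast hn
    rw [← Real.log_div (by positivity) hn0.ne']
    have := Real.log_le_sub_one_of_pos (x := ((n + 1 : ℕ) : ℝ) / n) (by positivity)
    refine this.trans (le_of_eq ?_)
    push_cast; field_simp; ring
  have e : ∑ n ∈ Ioc 0 N, a n * Real.log n = ∑ n ∈ range (N + 1), a n * Real.log n :=
    (sum_range_succ_eq_sum_Ioc (a.pmul ArithmeticFunction.log) N).symm
  rw [e, sum_range_mul_eq_by_parts]
  have h1 : |(∑ n ∈ range (N + 1), a n) * Real.log ((N + 1 : ℕ) : ℝ)| ≤ C * N * l ^ j := by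
    rw [abs_mul, sum_range_succ_eq_sum_Ioc, abs_of_nonneg (Real.log_natCast_nonneg _)]
    have h2 : Real.log ((N + 1 : ℕ) : ℝ) ≤ l := by
      have h3 := hlog N hN
      have : 1 / (N : ℝ) ≤ 1 := by
        rw [div_le_one (by positivity)]; exact_mod_cast hN
      linarith
    calc _ ≤ C * N * l ^ j / l * l :=
          mul_le_mul (ha N hN) h2 (Real.log_natCast_nonneg _) (by positivity)
      _ = _ := by field_simp
  have h2 : |∑ n ∈ range (N + 1), (∑ m ∈ range (n + 1), a m)
      * (Real.log n - Real.log ((n + 1 : ℕ) : ℝ))| ≤ C * N * l ^ j := by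
    calc _ ≤ ∑ n ∈ range (N + 1), |(∑ m ∈ range (n + 1), a m)
          * (Real.log n - Real.log ((n + 1 : ℕ) : ℝ))| := abs_sum_le_sum_abs _ _
      _ = ∑ n ∈ range N, |(∑ m ∈ range (n + 1 + 1), a m)
          * (Real.log ((n + 1 : ℕ) : ℝ) - Real.log ((n + 1 + 1 : ℕ) : ℝ))| := by
          rw [sum_range_succ']; simp
      _ ≤ ∑ n ∈ range N, C * l ^ j := by
          refine sum_le_sum fun n hn => ?_
          have hn' : n + 1 ≤ N := mem_range.mp hn
          have hl1 := one_add_log_nat_pos (n + 1)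
          have hl2 : 1 + Real.log ((n + 1 : ℕ) : ℝ) ≤ l := one_add_log_le_of_le hn'
          have hA := ha (n + 1) (by omega)
          have hd := hlog (n + 1) (by omega)
          have hn0 : (0 : ℝ) < ((n + 1 : ℕ) : ℝ) := by positivity
          have hm : Real.log ((n + 1 : ℕ) : ℝ) ≤ Real.log ((n + 1 + 1 : ℕ) : ℝ) :=
            Real.log_le_log hn0 (by push_cast; linarith)
          rw [abs_mul, sum_range_succ_eq_sum_Ioc, abs_sub_comm, abs_of_nonneg (sub_nonneg.mpr hm)]
          calc _ ≤ C * ((n + 1 : ℕ) : ℝ) * (1 + Real.log ((n + 1 : ℕ) : ℝ)) ^ j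
                / (1 + Real.log ((n + 1 : ℕ) : ℝ)) * (1 / ((n + 1 : ℕ) : ℝ)) :=
                mul_le_mul hA hd (sub_nonneg.mpr hm) (by positivity)
            _ = C * (1 + Real.log ((n + 1 : ℕ) : ℝ)) ^ j / (1 + Real.log ((n + 1 : ℕ) : ℝ)) := by
                field_simp
            _ ≤ C * (1 + Real.log ((n + 1 : ℕ) : ℝ)) ^ j := div_le_self (by positivity) hl1
            _ ≤ _ := by gcongr
      _ = _ := by rw [sum_const, card_range, nsmul_eq_mul]; ring
  calc _ ≤ _ := abs_add_le _ _
    _ ≤ C * N * l ^ j + C * N * l ^ j := add_le_add h1 h2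
    _ = _ := by ring

/-- Dirichlet convolution with a function whose summatory function is `O(M / (1 + log M)²)` loses
only a constant factor. -/
lemma exists_abs_sum_mul_le {b : ArithmeticFunction ℝ} {B : ℝ} (hB : 0 ≤ B)
    (hb : ∀ M : ℕ, 1 ≤ M → |∑ n ∈ Ioc 0 M, b n| ≤ B * M / (1 + Real.log M) ^ 2) :
    ∃ D : ℝ, 0 ≤ D ∧ ∀ (f : ArithmeticFunction ℝ) (C : ℝ) (j N : ℕ), (∀ n, 0 ≤ f n) → 0 ≤ C →
      (∀ M : ℕ, ∑ n ∈ Ioc 0 M, f n ≤ C * M * (1 + Real.log M) ^ j) →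
      |∑ n ∈ Ioc 0 N, (f * b) n| ≤ D * C * N * (1 + Real.log N) ^ j := by
  have hsum : Summable fun i : ℕ => 1 / ((i + 1 : ℕ) : ℝ) ^ 2 :=
    (summable_nat_add_iff 1).mpr (Real.summable_one_div_nat_pow.mpr one_lt_two)
  set Z := ∑' i : ℕ, 1 / ((i + 1 : ℕ) : ℝ) ^ 2 with hZ
  have hZ0 : 0 ≤ Z := tsum_nonneg fun i => by positivity
  refine ⟨8 * B * Z, by positivity, fun f C j N hf hC hF => ?_⟩
  have hl := one_add_log_nat_pos N
  set h : ℕ → ℝ := fun i => 8 * B * 2 ^ i / ((i + 1 : ℕ) : ℝ) ^ 2 with hh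
  have hR : ∀ M : ℕ, 1 ≤ M → |∑ n ∈ Ioc 0 M, b n| ≤ h (Nat.log 2 M) := by
    intro M hM
    have h1 : 2 ^ Nat.log 2 M ≤ M := Nat.pow_log_le_self 2 (by omega)
    have h2 : M < 2 ^ (Nat.log 2 M + 1) := Nat.lt_pow_succ_log_self (by norm_num) M
    set i := Nat.log 2 M
    have h3 : (M : ℝ) ≤ 2 * 2 ^ i := by
      have : (M : ℝ) < 2 ^ (i + 1) := by exact_mod_cast h2
      rw [pow_succ] at this; linarith
    have h4 := one_add_log_le_of_le h1
    push_cast at h4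
    rw [Real.log_pow] at h4
    have h5 : ((i + 1 : ℕ) : ℝ) / 2 ≤ 1 + Real.log M := by
      have := Real.log_two_gt_d9
      have : (i : ℝ) * (1 / 2) ≤ i * Real.log 2 := by gcongr; linarith
      push_cast; linarith
    calc _ ≤ _ := hb M hM
      _ ≤ B * (2 * 2 ^ i) / (((i + 1 : ℕ) : ℝ) / 2) ^ 2 := by gcongr
      _ = _ := by rw [hh]; field_simp; ring
  have hpt : ∀ m ∈ Ioc 0 N, |∑ n ∈ Ioc 0 (N / m), b n|
      ≤ ∑ i ∈ range (N + 1), if m ≤ N / 2 ^ i then h i else 0 := by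
    intro m hm
    obtain ⟨hm0, hmN⟩ := mem_Ioc.mp hm
    have hM : 1 ≤ N / m := Nat.div_pos hmN hm0
    have h1 : 2 ^ Nat.log 2 (N / m) ≤ N / m := Nat.pow_log_le_self 2 (by omega)
    have hmem : Nat.log 2 (N / m) ∈ range (N + 1) := by
      rw [mem_range, Nat.lt_succ_iff]
      exact (Nat.log_le_self 2 _).trans (Nat.div_le_self _ _)
    have hle : m ≤ N / 2 ^ Nat.log 2 (N / m) := by
      rw [Nat.le_div_iff_mul_le (by positivity), mul_comm]
      exact (Nat.le_div_iff_mul_le hm0).mp h1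
    refine (hR _ hM).trans ?_
    have := single_le_sum (f := fun i => if m ≤ N / 2 ^ i then h i else 0)
      (fun i _ => by split_ifs <;> positivity) hmem
    simpa only [if_pos hle] using this
  rw [ArithmeticFunction.sum_Ioc_mul_eq_sum_sum]
  calc _ ≤ ∑ m ∈ Ioc 0 N, f m * ∑ i ∈ range (N + 1), (if m ≤ N / 2 ^ i then h i else 0) := by
        refine (abs_sum_le_sum_abs _ _).trans (sum_le_sum fun m hm => ?_)
        rw [abs_mul, abs_of_nonneg (hf m)]
        exact mul_le_mul_of_nonneg_left (hpt m hm) (hf m)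
    _ = ∑ i ∈ range (N + 1), h i * ∑ m ∈ Ioc 0 (N / 2 ^ i), f m := by
        simp_rw [mul_sum]
        rw [sum_comm]
        refine sum_congr rfl fun i _ => ?_
        have hset : Ioc 0 (N / 2 ^ i) = {m ∈ Ioc 0 N | m ≤ N / 2 ^ i} := by
          ext m
          have := Nat.div_le_self N (2 ^ i)
          simp only [mem_Ioc, mem_filter]
          omega
        rw [hset, sum_filter]
        refine sum_congr rfl fun m _ => ?_
        split_ifs <;> ring
    _ ≤ ∑ i ∈ range (N + 1), 8 * B * C * N * (1 + Real.log N) ^ j * (1 / ((i + 1 : ℕ) : ℝ) ^ 2) := by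
        refine sum_le_sum fun i _ => ?_
        have h1 : ((N / 2 ^ i : ℕ) : ℝ) ≤ N / 2 ^ i := by
          have := Nat.cast_div_le (α := ℝ) (m := N) (n := 2 ^ i)
          push_cast at this; exact this
        have h2 := one_add_log_le_of_le (Nat.div_le_self N (2 ^ i))
        have h3 := one_add_log_nat_pos (N / 2 ^ i)
        calc _ ≤ h i * (C * (N / 2 ^ i) * (1 + Real.log N) ^ j) := by
              refine mul_le_mul_of_nonneg_left ((hF _).trans ?_) (by positivity)
              gcongr
          _ = _ := by rw [hh]; field_simp
    _ = 8 * B * C * N * (1 + Real.log N) ^ j * ∑ i ∈ range (N + 1), 1 / ((i + 1 : ℕ) : ℝ) ^ 2 := by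
        rw [mul_sum]
    _ ≤ 8 * B * C * N * (1 + Real.log N) ^ j * Z := by
        gcongr
        exact hsum.sum_le_tsum _ fun i _ => by positivity
    _ = _ := by ring

lemma sum_logPow_le (j N : ℕ) : ∑ n ∈ Ioc 0 N, logPow j n ≤ N * (1 + Real.log N) ^ j := by
  calc _ ≤ ∑ n ∈ Ioc 0 N, (1 + Real.log N) ^ j := by
        refine sum_le_sum fun n hn => ?_
        obtain ⟨hn0, hnN⟩ := mem_Ioc.mp hn
        rw [logPow_apply hn0.ne']
        have := one_add_log_le_of_le hnN
        exact pow_le_pow_left₀ (Real.log_natCast_nonneg n) (by linarith) j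
    _ = _ := by simp

lemma exists_abs_sum_genDeviation_le (j : ℕ) : ∃ C : ℝ, 0 ≤ C ∧ ∀ N : ℕ, 1 ≤ N →
    |∑ n ∈ Ioc 0 N, genDeviation j n| ≤ C * N * (1 + Real.log N) ^ j / (1 + Real.log N) := by
  obtain ⟨B, hB, hR⟩ := exists_abs_sum_vonMangoldt_sub_one_le
  have hR' : ∀ M : ℕ, 1 ≤ M → |∑ n ∈ Ioc 0 M, (Λ - (ζ : ArithmeticFunction ℝ)) n|
      ≤ B * M / (1 + Real.log M) ^ 2 := by
    intro M hM
    convert hR M hM using 2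
    refine sum_congr rfl fun n hn => ?_
    have hn0 := (mem_Ioc.mp hn).1.ne'
    rw [sub_apply]
    simp [hn0]
  induction j with
  | zero =>
    refine ⟨B, hB.le, fun N hN => ?_⟩
    have hl := one_add_log_nat_pos N
    have e : ∀ n, genDeviation 0 n = (Λ - (ζ : ArithmeticFunction ℝ)) n := by
      intro n
      rw [genDeviation_apply, zero_add, genVonMangoldt_one, logPow_zero, sub_apply]
      simp
    simp_rw [e]
    refine (hR' N hN).trans ?_
    rw [pow_zero, mul_one]
    gcongr
    nlinarith
  | succ j ih =>
    obtain ⟨C, hC, hE⟩ := ih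
    obtain ⟨D, hD, hconv⟩ := exists_abs_sum_mul_le hB.le hR'
    have hF : ∀ M : ℕ, ∑ n ∈ Ioc 0 M, genVonMangoldt (j + 1) n
        ≤ (C + (j + 1)) * M * (1 + Real.log M) ^ j := by
      intro M
      rcases Nat.eq_zero_or_pos M with rfl | hM
      · simp
      have hl := one_add_log_nat_pos M
      have h1 := (abs_le.mp (hE M hM)).2
      simp_rw [genDeviation_apply] at h1
      rw [sum_sub_distrib, ← mul_sum] at h1
      have h2 := mul_le_mul_of_nonneg_left (sum_logPow_le j M) (by positivity : (0 : ℝ) ≤ j + 1)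
      have h3 : C * M * (1 + Real.log M) ^ j / (1 + Real.log M) ≤ C * M * (1 + Real.log M) ^ j :=
        div_le_self (by positivity) hl
      linarith
    refine ⟨2 * C + D * (C + (j + 1)), by positivity, fun N hN => ?_⟩
    have hl := one_add_log_nat_pos N
    simp_rw [genDeviation_succ_apply]
    rw [sum_add_distrib]
    calc _ ≤ _ := abs_add_le _ _
      _ ≤ 2 * C * N * (1 + Real.log N) ^ j + D * (C + (j + 1)) * N * (1 + Real.log N) ^ j :=
          add_le_add (abs_sum_mul_log_le hC hE hN)
            (hconv _ _ j N (genVonMangoldt_nonneg _) (by positivity) hF)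
      _ = _ := by field_simp; ring

lemma mul_log_sub_le_sum_log {N : ℕ} (hN : 1 ≤ N) :
    N * Real.log N - N ≤ ∑ n ∈ Ioc 0 N, Real.log n := by
  induction N, hN using Nat.le_induction with
  | base => simp
  | succ N hN ih =>
    have hN0 : (0 : ℝ) < N := by exact_mod_cast hN
    rw [sum_Ioc_succ_top (Nat.zero_le N)]
    have h1 := Real.log_le_sub_one_of_pos (x := ((N + 1 : ℕ) : ℝ) / N) (by positivity)
    rw [Real.log_div (by positivity) hN0.ne'] at h1
    have h2 := mul_le_mul_of_nonneg_left h1 hN0.le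
    have h3 : (N : ℝ) * (((N + 1 : ℕ) : ℝ) / N - 1) = 1 := by push_cast; field_simp; ring
    rw [h3] at h2
    push_cast at h2 ⊢
    linarith

lemma abs_sum_logPow_sub_le (j : ℕ) {x : ℝ} (hx : 3 ≤ x) :
    |∑ n ∈ Ioc 0 ⌊x⌋₊, logPow j n - x * Real.log x ^ j|
      ≤ (j + 1) * (x * Real.log x ^ j / Real.log x) := by
  have hx0 : 0 < x := by linarith
  have hlog : 1 ≤ Real.log x := by
    rw [Real.le_log_iff_exp_le hx0]; linarith [Real.exp_one_lt_d9]
  set l := Real.log x with hl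
  set N := ⌊x⌋₊ with hN
  have hN1 : 1 ≤ N := Nat.le_floor (by norm_num; linarith)
  have hNx : (N : ℝ) ≤ x := Nat.floor_le hx0.le
  have hxN : x ≤ N + 1 := (Nat.lt_floor_add_one x).le
  have hN0 : (0 : ℝ) < N := by exact_mod_cast hN1
  have hlx : l ≤ x := (Real.log_le_sub_one_of_pos hx0).trans (by linarith)
  have hpt : ∀ n ∈ Ioc 0 N, l ^ j - logPow j n ≤ j * (l ^ j / l) * (l - Real.log n) := by
    intro n hn
    obtain ⟨hn0, -⟩ := mem_Ioc.mp hn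
    rw [logPow_apply hn0.ne']
    have hb := one_add_mul_le_pow (a := Real.log n / l - 1)
      (by have : 0 ≤ Real.log n / l := div_nonneg (Real.log_natCast_nonneg n) (by linarith)
          linarith) j
    rw [add_sub_cancel, div_pow, le_div_iff₀ (by positivity)] at hb
    have e : j * (l ^ j / l) * (l - Real.log n) = -(j * (Real.log n / l - 1)) * l ^ j := by
      field_simp; ring
    rw [e]; linarith
  have hle : ∀ n ∈ Ioc 0 N, logPow j n ≤ l ^ j := by
    intro n hn
    obtain ⟨hn0, hnN⟩ := mem_Ioc.mp hn
    rw [logPow_apply hn0.ne']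
    refine pow_le_pow_left₀ (Real.log_natCast_nonneg n) (Real.log_le_log (by exact_mod_cast hn0) ?_) j
    exact le_trans (by exact_mod_cast hnN) hNx
  have hup : ∑ n ∈ Ioc 0 N, logPow j n ≤ x * l ^ j := by
    calc _ ≤ ∑ n ∈ Ioc 0 N, l ^ j := sum_le_sum hle
      _ = N * l ^ j := by simp
      _ ≤ _ := by gcongr
  have hlo : N * l ^ j - ∑ n ∈ Ioc 0 N, logPow j n ≤ j * (l ^ j / l) * x := by
    have h1 : ∑ n ∈ Ioc 0 N, (l - Real.log n) ≤ x := by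
      rw [sum_sub_distrib, sum_const, Nat.card_Ioc, nsmul_eq_mul, Nat.sub_zero]
      have h2 := mul_log_sub_le_sum_log hN1
      have h3 := Real.log_le_sub_one_of_pos (x := x / N) (by positivity)
      rw [Real.log_div hx0.ne' hN0.ne'] at h3
      have h4 := mul_le_mul_of_nonneg_left h3 hN0.le
      have h5 : (N : ℝ) * (x / N - 1) = x - N := by field_simp
      rw [h5] at h4
      linarith
    calc _ = ∑ n ∈ Ioc 0 N, (l ^ j - logPow j n) := by simp [sum_sub_distrib]
      _ ≤ ∑ n ∈ Ioc 0 N, j * (l ^ j / l) * (l - Real.log n) := sum_le_sum hpt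
      _ = j * (l ^ j / l) * ∑ n ∈ Ioc 0 N, (l - Real.log n) := by rw [mul_sum]
      _ ≤ _ := by gcongr
  have hfrac : (x - N) * l ^ j ≤ x * l ^ j / l := by
    calc (x - N) * l ^ j ≤ 1 * l ^ j := by gcongr; linarith
      _ ≤ x / l * l ^ j := by gcongr; rw [one_le_div (by linarith)]; exact hlx
      _ = _ := by ring
  rw [abs_sub_comm, abs_of_nonneg (by linarith)]
  calc _ = (N * l ^ j - ∑ n ∈ Ioc 0 N, logPow j n) + (x - N) * l ^ j := by ring
    _ ≤ j * (l ^ j / l) * x + x * l ^ j / l := add_le_add hlo hfrac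
    _ = _ := by ring

lemma exists_abs_sum_genVonMangoldt_sub_le (j : ℕ) : ∃ C : ℝ, ∀ x : ℝ, 3 ≤ x →
    |∑ n ∈ Ioc 0 ⌊x⌋₊, genVonMangoldt (j + 1) n - (j + 1) * x * Real.log x ^ j|
      ≤ C * (x * Real.log x ^ j / Real.log x) := by
  obtain ⟨C, hC, hE⟩ := exists_abs_sum_genDeviation_le j
  refine ⟨C * 2 ^ j + (j + 1) * (j + 1), fun x hx => ?_⟩
  have hx0 : 0 < x := by linarith
  have hlog : 1 ≤ Real.log x := by
    rw [Real.le_log_iff_exp_le hx0]; linarith [Real.exp_one_lt_d9]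
  have hN1 : 1 ≤ ⌊x⌋₊ := Nat.le_floor (by norm_num; linarith)
  have hNx : (⌊x⌋₊ : ℝ) ≤ x := Nat.floor_le hx0.le
  have hxN : x ≤ ⌊x⌋₊ + 1 := (Nat.lt_floor_add_one x).le
  have h1 := hE _ hN1
  have h2 := abs_sum_logPow_sub_le j hx
  set N := ⌊x⌋₊ with hN
  have hN0 : (1 : ℝ) ≤ N := by exact_mod_cast hN1
  have hNlog : Real.log N ≤ Real.log x := Real.log_le_log (by linarith) hNx
  have hlogN : Real.log x ≤ 1 + Real.log N := by
    have h3 : Real.log x ≤ Real.log (2 * N) := Real.log_le_log hx0 (by linarith)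
    rw [Real.log_mul (by norm_num) (by linarith)] at h3
    linarith [Real.log_two_lt_d9]
  have h3 : |∑ n ∈ Ioc 0 N, genDeviation j n|
      ≤ C * 2 ^ j * (x * Real.log x ^ j / Real.log x) := by
    calc _ ≤ _ := h1
      _ ≤ C * x * (2 * Real.log x) ^ j / Real.log x := by
          have := one_add_log_nat_pos N
          gcongr
          linarith
      _ = _ := by rw [mul_pow]; ring
  have e : ∑ n ∈ Ioc 0 N, genVonMangoldt (j + 1) n - (j + 1) * x * Real.log x ^ j
      = ∑ n ∈ Ioc 0 N, genDeviation j n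
        + (j + 1) * (∑ n ∈ Ioc 0 N, logPow j n - x * Real.log x ^ j) := by
    simp_rw [genDeviation_apply]
    rw [sum_sub_distrib, ← mul_sum]
    ring
  rw [e]
  refine (abs_add_le _ _).trans ?_
  rw [abs_mul, abs_of_nonneg (by positivity : (0 : ℝ) ≤ j + 1)]
  have h4 := mul_le_mul_of_nonneg_left h2 (by positivity : (0 : ℝ) ≤ j + 1)
  linarith

end SumVonMangoldtK

/-- Fix `k ∈ ℕ`, `k ≥ 1`. Then
`Σ_{n ≤ x} Λ_k(n) = k x (log x)^{k−1} (1 + O(1/log x))` as `x → ∞`. -/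
theorem sum_vonMangoldtK (k : ℕ) (hk : 1 ≤ k) :
    (fun x : ℝ =>
        (∑ n ∈ Finset.Icc 1 ⌊x⌋₊, vonMangoldtK k n) - k * x * Real.log x ^ (k - 1))
      =O[atTop] fun x : ℝ => k * x * Real.log x ^ (k - 1) / Real.log x := by
  obtain ⟨j, rfl⟩ : ∃ j, k = j + 1 := ⟨k - 1, by omega⟩
  obtain ⟨C, hC⟩ := SumVonMangoldtK.exists_abs_sum_genVonMangoldt_sub_le j
  refine Asymptotics.IsBigO.of_bound (C / (j + 1)) ?_
  filter_upwards [eventually_ge_atTop 3] with x hx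
  have hlog : 0 ≤ Real.log x := Real.log_nonneg (by linarith)
  have h := hC x hx
  rw [Nat.add_sub_cancel, Real.norm_eq_abs, Real.norm_of_nonneg (by positivity)]
  simp_rw [← SumVonMangoldtK.genVonMangoldt_apply]
  have e : Icc 1 ⌊x⌋₊ = Ioc 0 ⌊x⌋₊ := rfl
  rw [e]
  push_cast
  refine h.trans (le_of_eq ?_)
  field_simp
end
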